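/- Let T be a complete strongly minimal arithmetically definable theory in a countable arithmetically definable language (so in particular T has no finite models). Then T is D-categorical for every nonzero arithmetic degree D. -/

import Mathlib

open FirstOrder FirstOrder.Language

namespace ArMorley

/-! ## Arithmetical sets and arithmetic reducibility -/

/-- Function symbols of the language of arithmetic: `0`, `1`, `+`, `·`. -/
inductive ArFunc : ℕ → Type
  | zero : ArFunc 0
  | one : ArFunc 0
  | add : ArFunc 2
  | mul : ArFunc 2

/-- Relation symbols: `<` and a unary oracle predicate. -/
inductive ArRel : ℕ → Type
  | lt : ArRel 2
  | mem : ArRel 1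

/-- The language `(+, ·, 0, 1, <, Y)` of arithmetic with a unary oracle predicate. -/
def arithLang : FirstOrder.Language := ⟨ArFunc, ArRel⟩

/-- The standard structure on `ℕ`, with the oracle predicate interpreted by `Y`. -/
def arithStructure (Y : Set ℕ) : arithLang.Structure ℕ where
  funMap := fun {n} f =>
    match f with
    | ArFunc.zero => fun _ => 0
    | ArFunc.one => fun _ => 1
    | ArFunc.add => fun v => v 0 + v 1
    | ArFunc.mul => fun v => v 0 * v 1
  RelMap := fun {n} r =>
    match r with
    | ArRel.lt => fun v => v 0 < v 1
    | ArRel.mem => fun v => v 0 ∈ Y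

/-- `X ≤_ar Y` : `X` is definable without parameters in `(ℕ, +, ·, 0, 1, <, Y)`. -/
def ArReducible (X Y : Set ℕ) : Prop :=
  letI := arithStructure Y
  ∃ φ : arithLang.Formula (Fin 1), X = { n : ℕ | φ.Realize (fun _ => n) }

/-- `X` is arithmetical: definable without parameters in `(ℕ, +, ·, 0, 1, <)`. -/
def IsArithmetical (X : Set ℕ) : Prop := ArReducible X ∅

/-- `X` and `Y` have the same arithmetic degree. -/
def ArEquiv (X Y : Set ℕ) : Prop := ArReducible X Y ∧ ArReducible Y X

/-! ## Coding conventions -/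

/-- Code of a list of naturals. -/
def listCode (l : List ℕ) : ℕ := Encodable.encode l

/-- Code of a finite tuple of naturals. -/
def tupleCode {n : ℕ} (v : Fin n → ℕ) : ℕ := listCode (List.ofFn v)

/-- The subset of `ℕ` corresponding to a set of elements of a coded domain. -/
def subCode {A : Set ℕ} (S : Set ↥A) : Set ℕ := Subtype.val '' S

/-- Code of a set of `n`-tuples from a coded domain as a subset of `ℕ`. -/
def tupleSetCode {A : Set ℕ} {n : ℕ} (X : Set (Fin n → ↥A)) : Set ℕ :=
  { c : ℕ | ∃ v ∈ X, c = tupleCode (fun i => ((v i : ℕ))) }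

/-- Code of the graph of a function between coded domains. -/
def graphCode {A B : Set ℕ} (f : ↥A → ↥B) : Set ℕ :=
  { c : ℕ | ∃ a : ↥A, c = Nat.pair (a : ℕ) ((f a : ℕ)) }

/-! ## Gödel coded languages -/

/-- A fixed Gödel coding of the symbols of a countable first-order language. -/
structure GoedelCoding (L : FirstOrder.Language) where
  encFun : ∀ n, L.Functions n → ℕ
  encFun_inj : ∀ n, Function.Injective (encFun n)
  encRel : ∀ n, L.Relations n → ℕ
  encRel_inj : ∀ n, Function.Injective (encRel n)

variable {L : FirstOrder.Language}

/-- The set of codes of the symbols of `L`. -/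
def symbolCodes (g : GoedelCoding L) : Set ℕ :=
  { c | (∃ (n : ℕ) (f : L.Functions n), c = Nat.pair 0 (Nat.pair n (g.encFun n f))) ∨
        (∃ (n : ℕ) (R : L.Relations n), c = Nat.pair 1 (Nat.pair n (g.encRel n R))) }

/-- `L` is an arithmetically definable language. -/
def ArithLang (g : GoedelCoding L) : Prop := IsArithmetical (symbolCodes g)

/-- Code of a term, with a given coding of the variables. -/
def termCode (g : GoedelCoding L) {α : Type} (encα : α → ℕ) (t : L.Term α) : ℕ :=
  listCode (t.listEncode.map (Sum.elim (fun a => Nat.pair 0 (encα a))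
    (fun p => Nat.pair 1 (Nat.pair p.1 (g.encFun p.1 p.2)))))

/-- Code of a (bounded) formula, with a given coding of free variables. -/
def formulaCode (g : GoedelCoding L) {α : Type} (encα : α → ℕ) {n : ℕ}
    (φ : L.BoundedFormula α n) : ℕ :=
  listCode (φ.listEncode.map (Sum.elim
    (fun p => Nat.pair 0 (Nat.pair p.1
      (termCode g (Sum.elim (fun a => Nat.pair 0 (encα a)) (fun i => Nat.pair 1 i.1)) p.2)))
    (Sum.elim
      (fun q => Nat.pair 1 (Nat.pair q.1 (g.encRel q.1 q.2)))
      (fun m => Nat.pair 2 m))))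

/-- Code of a sentence. -/
def sentenceCode (g : GoedelCoding L) (φ : L.Sentence) : ℕ :=
  formulaCode g (fun a : Empty => a.elim) φ

/-- The set of codes of the axioms of a theory. -/
def theoryCode (g : GoedelCoding L) (T : L.Theory) : Set ℕ :=
  { c | ∃ φ ∈ T, c = sentenceCode g φ }

/-- `T` is an arithmetically definable theory. -/
def ArithTheory (g : GoedelCoding L) (T : L.Theory) : Prop := IsArithmetical (theoryCode g T)

/-! ## Coded structures -/

/-- A coded `L`-structure: an `L`-structure whose domain is a subset of `ℕ`
with infinite complement. -/
structure CodedStructure (L : FirstOrder.Language) where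
  carrier : Set ℕ
  compl_infinite : (carrierᶜ : Set ℕ).Infinite
  struc : L.Structure ↥carrier

/-- A coded structure is a model of `T`. -/
def CodedStructure.Models (M : CodedStructure L) (T : L.Theory) : Prop :=
  ∀ φ ∈ T, @Sentence.Realize L ↥M.carrier M.struc φ

/-- The (coded) elementary diagram of a coded structure. -/
def elemDiagram (g : GoedelCoding L) (M : CodedStructure L) : Set ℕ :=
  { c | ∃ (k : ℕ) (φ : L.Formula (Fin k)) (a : Fin k → ↥M.carrier),
      c = Nat.pair (Nat.pair k (formulaCode g Fin.val φ)) (tupleCode fun i => ((a i : ℕ))) ∧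
      (letI := M.struc; φ.Realize a) }

/-- A coded structure is arithmetically decidable if its elementary diagram is arithmetical. -/
def ArithDecidable (g : GoedelCoding L) (M : CodedStructure L) : Prop :=
  IsArithmetical (elemDiagram g M)

/-- `M ≼ N` for coded structures: `M`'s domain is contained in `N`'s, and the
inclusion is elementary. -/
structure ElemSub (M N : CodedStructure L) : Prop where
  subset : M.carrier ⊆ N.carrier
  elem : ∀ (k : ℕ) (φ : L.Formula (Fin k)) (a : Fin k → ↥M.carrier),
    (letI := M.struc; φ.Realize a) ↔
      (letI := N.struc; φ.Realize (fun i => (⟨((a i : ℕ)), subset (a i).2⟩ : ↥N.carrier)))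

/-- A coded model of `T` is arithmetically extendible if it is an elementary substructure of
an arithmetically decidable coded model of `T`. -/
def ArithExtendible (g : GoedelCoding L) (T : L.Theory) (M : CodedStructure L) : Prop :=
  ∃ N : CodedStructure L, ArithDecidable g N ∧ N.Models T ∧ ElemSub M N

/-! ## Model-theoretic notions in arbitrary structures -/

/-- `N` (with structure `SN`) is a model of `T`. -/
def ModelsT (L : FirstOrder.Language) (T : L.Theory) (N : Type) (SN : L.Structure N) : Prop :=
  ∀ φ ∈ T, @Sentence.Realize L N SN φ

/-- `T` has no finite models. -/
def NoFiniteModels (L : FirstOrder.Language) (T : L.Theory) : Prop :=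
  ∀ (N : Type) (SN : L.Structure N), ModelsT L T N SN → Infinite N

/-- Elementary embeddings, with the structures given explicitly. -/
def EEmb (L : FirstOrder.Language) (M : Type) (SM : L.Structure M)
    (N : Type) (SN : L.Structure N) : Type _ :=
  @FirstOrder.Language.ElementaryEmbedding L M N SM SN

/-- The underlying map of an elementary embedding. -/
def EEmb.fn {L : FirstOrder.Language} {M : Type} {SM : L.Structure M}
    {N : Type} {SN : L.Structure N} (j : EEmb L M SM N SN) : M → N :=
  @FirstOrder.Language.ElementaryEmbedding.toFun L M N SM SN j

/-- A subset of `N^n` definable with parameters from `P`. -/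
def DefinableOverT (L : FirstOrder.Language) (N : Type) (SN : L.Structure N) (P : Set N)
    {n : ℕ} (X : Set (Fin n → N)) : Prop :=
  letI := SN
  ∃ (m : ℕ) (ψ : L.Formula (Fin n ⊕ Fin m)) (b : Fin m → N),
    (∀ i, b i ∈ P) ∧ X = { v | ψ.Realize (Sum.elim v b) }

/-- A subset of `N` definable with (arbitrary) parameters. -/
def Definable1 (L : FirstOrder.Language) (N : Type) (SN : L.Structure N) (Y : Set N) : Prop :=
  letI := SN
  ∃ (m : ℕ) (ψ : L.Formula (Fin 1 ⊕ Fin m)) (b : Fin m → N),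
    Y = { x : N | ψ.Realize (Sum.elim (fun _ => x) b) }

/-- The algebraic closure of `B` in `N`: elements satisfying a formula with parameters
from `B` having finitely many solutions. -/
def aclIn (L : FirstOrder.Language) (N : Type) (SN : L.Structure N) (B : Set N) : Set N :=
  letI := SN
  { a : N | ∃ (k : ℕ) (φ : L.Formula (Fin 1 ⊕ Fin k)) (b : Fin k → N),
      (∀ i, b i ∈ B) ∧ φ.Realize (Sum.elim (fun _ => a) b) ∧
      { x : N | φ.Realize (Sum.elim (fun _ => x) b) }.Finite }

/-- The domain of the substructure of `N` generated by `B`: values of terms at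
arguments from `B`. -/
def genSub (L : FirstOrder.Language) (N : Type) (SN : L.Structure N) (B : Set N) : Set N :=
  letI := SN
  { a : N | ∃ (t : L.Term ℕ) (v : ℕ → N), (∀ i, v i ∈ B) ∧ a = t.realize v }

/-- The set defined by a formula `φ(x, p̄)` in one free variable with parameters `p̄`. -/
def smSet (L : FirstOrder.Language) (N : Type) (SN : L.Structure N) {k : ℕ}
    (φ : L.Formula (Fin 1 ⊕ Fin k)) (p : Fin k → N) : Set N :=
  letI := SN
  { x : N | φ.Realize (Sum.elim (fun _ => x) p) }

/-- A definable tuple-set in a coded structure, with parameters from `P`. -/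
def DefinableOver (M : CodedStructure L) (P : Set ↥M.carrier) {n : ℕ}
    (X : Set (Fin n → ↥M.carrier)) : Prop :=
  DefinableOverT L ↥M.carrier M.struc P X

/-- A definable tuple-set in a coded structure, with arbitrary parameters. -/
def DefinableIn (M : CodedStructure L) {n : ℕ} (X : Set (Fin n → ↥M.carrier)) : Prop :=
  DefinableOver M Set.univ X

/-! ## Isomorphisms of coded structures and `D`-categoricity -/

/-- An isomorphism of coded `L`-structures. -/
structure CodedIso (M N : CodedStructure L) where
  toFun : ↥M.carrier → ↥N.carrier
  invFun : ↥N.carrier → ↥M.carrier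
  left_inv : Function.LeftInverse invFun toFun
  right_inv : Function.RightInverse invFun toFun
  map_fun : ∀ {k : ℕ} (f : L.Functions k) (v : Fin k → ↥M.carrier),
    toFun (M.struc.funMap f v) = N.struc.funMap f (toFun ∘ v)
  map_rel : ∀ {k : ℕ} (r : L.Relations k) (v : Fin k → ↥M.carrier),
    M.struc.RelMap r v ↔ N.struc.RelMap r (toFun ∘ v)

/-- `f` is a `D`-preserving isomorphism, where `d` is a representative of the
arithmetic degree `D`. -/
def DPreserving (d : Set ℕ) {M N : CodedStructure L} (f : CodedIso M N) : Prop :=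
  ArReducible (graphCode f.toFun) d ∧
  ArReducible (graphCode f.invFun) d ∧
  (∀ (n : ℕ) (X : Set (Fin n → ↥M.carrier)), DefinableIn M X →
      ArEquiv (tupleSetCode X) d →
      ArEquiv (tupleSetCode ((fun v => f.toFun ∘ v) '' X)) d) ∧
  (∀ (n : ℕ) (Y : Set (Fin n → ↥N.carrier)), DefinableIn N Y →
      ArEquiv (tupleSetCode Y) d →
      ArEquiv (tupleSetCode ((fun v => f.invFun ∘ v) '' Y)) d)

/-- `T` is `D`-categorical, where `d` is a representative of the nonzero
arithmetic degree `D`. -/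
def DCategorical (g : GoedelCoding L) (T : L.Theory) (d : Set ℕ) : Prop :=
  ∀ M₀ M₁ M₂ : CodedStructure L,
    ArithDecidable g M₀ → M₀.Models T →
    M₁.Models T → ArithExtendible g T M₁ →
    M₂.Models T → ArithExtendible g T M₂ →
    ElemSub M₀ M₁ → ElemSub M₀ M₂ →
    ArEquiv M₁.carrier d → ArEquiv M₂.carrier d →
    ∃ f : CodedIso M₁ M₂, DPreserving d f ∧
      ∀ (x : ℕ) (hx : x ∈ M₀.carrier) (h₁ : x ∈ M₁.carrier),
        ((f.toFun ⟨x, h₁⟩ : ℕ)) = x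

/-! ## Vaughtian pairs, prime models, strong minimality -/

/-- `T` has a Vaughtian pair. -/
def HasVaughtianPair (T : L.Theory) : Prop :=
  ∃ (N : Type) (SN : L.Structure N),
    ModelsT L T N SN ∧
    ∃ S : @FirstOrder.Language.ElementarySubstructure L N SN,
      ((S.toSubstructure : Set N) ≠ Set.univ ∧
      ∃ (k : ℕ) (φ : L.Formula (Fin 1 ⊕ Fin k)) (a : Fin k → N),
        (∀ i, a i ∈ (S.toSubstructure : Set N)) ∧
        smSet L N SN φ a ⊆ (S.toSubstructure : Set N) ∧
        (smSet L N SN φ a).Infinite)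

/-- A coded model of `T` is prime: it elementarily embeds into every model of `T`. -/
def PrimeModel (L : FirstOrder.Language) (T : L.Theory) (P : CodedStructure L) : Prop :=
  P.Models T ∧ ∀ (N : Type) (SN : L.Structure N), ModelsT L T N SN →
    Nonempty (EEmb L ↥P.carrier P.struc N SN)

/-- `φ(x, p̄)` is strongly minimal over the coded model `M`: its solution set in `M` is
infinite, and in every elementary extension of `M` modelling `T` every definable subset of
its solution set is finite or cofinite in it. -/
def StronglyMinimalOver (T : L.Theory) (M : CodedStructure L) {k : ℕ}
    (φ : L.Formula (Fin 1 ⊕ Fin k)) (p : Fin k → ↥M.carrier) : Prop :=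
  (smSet L ↥M.carrier M.struc φ p).Infinite ∧
  ∀ (N : Type) (SN : L.Structure N), ModelsT L T N SN →
    ∀ j : EEmb L ↥M.carrier M.struc N SN,
      ∀ Y : Set N, Definable1 L N SN Y →
        Y ⊆ smSet L N SN φ (fun i => j.fn (p i)) →
        (Y.Finite ∨ ((smSet L N SN φ (fun i => j.fn (p i))) \ Y).Finite)

/-- `T` is a strongly minimal theory: every model is infinite, and every
parameter-definable subset of any model is finite or cofinite. -/
def StronglyMinimalTheory (L : FirstOrder.Language) (T : L.Theory) : Prop :=
  (∀ (N : Type) (SN : L.Structure N), ModelsT L T N SN → Infinite N) ∧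
  (∀ (N : Type) (SN : L.Structure N), ModelsT L T N SN →
    ∀ Y : Set N, Definable1 L N SN Y → (Y.Finite ∨ (Yᶜ : Set N).Finite))

/-- The structural control clause: an arithmetically decidable prime model together with
a strongly minimal formula over it generating every elementary extension. -/
def GeneratesAll (T : L.Theory) (P : CodedStructure L) {k : ℕ}
    (φ : L.Formula (Fin 1 ⊕ Fin k)) (p : Fin k → ↥P.carrier) : Prop :=
  ∀ (N : Type) (SN : L.Structure N), ModelsT L T N SN →
    ∀ j : EEmb L ↥P.carrier P.struc N SN,
      aclIn L N SN (Set.range j.fn ∪ smSet L N SN φ (fun i => j.fn (p i))) = Set.univ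

/-- Clause (3) of the arithmetic Baldwin–Lachlan theorem. -/
def SMControl (g : GoedelCoding L) (T : L.Theory) : Prop :=
  ∃ (P : CodedStructure L), ArithDecidable g P ∧ PrimeModel L T P ∧
    ∃ (k : ℕ) (φ : L.Formula (Fin 1 ⊕ Fin k)) (p : Fin k → ↥P.carrier),
      StronglyMinimalOver T P φ p ∧ GeneratesAll T P φ p

/-! ## Types and arithmetical stability -/

/-- A formula with a finite parameter tuple from a coded structure, in `n` object
variables. -/
def ParamFormula (L : FirstOrder.Language) (M : CodedStructure L) (n : ℕ) : Type :=
  Σ k : ℕ, L.Formula (Fin n ⊕ Fin k) × (Fin k → ↥M.carrier)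

/-- All parameters of `q` lie in `A`. -/
def paramsIn {M : CodedStructure L} {n : ℕ} (A : Set ℕ) (q : ParamFormula L M n) : Prop :=
  ∀ i, ((q.2.2 i : ℕ)) ∈ A

/-- `p` is consistent with the elementary diagram of `M`: it is realized in some
elementary extension of `M`. -/
def TypeConsistent (M : CodedStructure L) {n : ℕ} (p : Set (ParamFormula L M n)) : Prop :=
  ∃ (N : Type) (SN : L.Structure N) (j : EEmb L ↥M.carrier M.struc N SN) (b : Fin n → N),
    ∀ q ∈ p, letI := SN; q.2.1.Realize (Sum.elim b (fun i => j.fn (q.2.2 i)))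

/-- `p` is a (complete) `n`-type over `A` inside `M`: a maximal set of formulas with
parameters from `A` consistent with the elementary diagram of `M`. -/
def IsNType (M : CodedStructure L) (A : Set ℕ) (n : ℕ)
    (p : Set (ParamFormula L M n)) : Prop :=
  (∀ q ∈ p, paramsIn A q) ∧
  TypeConsistent M p ∧
  ∀ q : ParamFormula L M n, paramsIn A q → q ∉ p → ¬ TypeConsistent M (insert q p)

/-- The code of a formula-with-parameters. -/
def pfCode (g : GoedelCoding L) {M : CodedStructure L} {n : ℕ} (q : ParamFormula L M n) : ℕ :=
  Nat.pair
    (Nat.pair q.1 (formulaCode g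
      (Sum.elim (fun i : Fin n => Nat.pair 0 i.1) (fun j : Fin q.1 => Nat.pair 1 j.1)) q.2.1))
    (tupleCode fun i => ((q.2.2 i : ℕ)))

/-- The set of codes of the formulas of `p`. -/
def typeCode (g : GoedelCoding L) {M : CodedStructure L} {n : ℕ}
    (p : Set (ParamFormula L M n)) : Set ℕ :=
  { c | ∃ q ∈ p, c = pfCode g q }

/-- `p` is realized in the coded elementary extension `N` of `M`. -/
def RealizesType {M N : CodedStructure L} (h : M.carrier ⊆ N.carrier) {n : ℕ}
    (p : Set (ParamFormula L M n)) : Prop :=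
  ∃ b : Fin n → ↥N.carrier, ∀ q ∈ p,
    letI := N.struc
    q.2.1.Realize (Sum.elim b (fun i => (⟨((q.2.2 i : ℕ)), h (q.2.2 i).2⟩ : ↥N.carrier)))

/-- The `(n, i)`-th column of an effective join. -/
def tripleSection (X : Set ℕ) (n i : ℕ) : Set ℕ := { m | Nat.pair n (Nat.pair i m) ∈ X }

/-- `T` is arithmetically stable: over every arithmetically decidable model and every
arithmetical parameter set, the family of arithmetic `n`-types (for all `n ≥ 1`) has a
uniform arithmetical code in which every arithmetic `n`-type appears at least once. -/
def ArithStable (g : GoedelCoding L) (T : L.Theory) : Prop :=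
  ∀ M : CodedStructure L, ArithDecidable g M → M.Models T →
    ∀ A : Set ℕ, A ⊆ M.carrier → IsArithmetical A →
      ∃ X : Set ℕ, IsArithmetical X ∧
        (∀ n, 1 ≤ n → ∀ i : ℕ, ∃ p : Set (ParamFormula L M n),
            IsNType M A n p ∧ IsArithmetical (typeCode g p) ∧
            tripleSection X n i = typeCode g p) ∧
        (∀ n, 1 ≤ n → ∀ p : Set (ParamFormula L M n),
            IsNType M A n p → IsArithmetical (typeCode g p) →
            ∃ i : ℕ, tripleSection X n i = typeCode g p)

/-- The set of elements occurring as a coordinate of a tuple in `X`. -/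
def coordSet {N : Type} {n : ℕ} (X : Set (Fin n → N)) : Set N :=
  { m | ∃ v ∈ X, ∃ i, v i = m }


/-! ## Definability in arithmetic with an oracle -/

/-- A property of assignments `α → ℕ` is definable in arithmetic with oracle `Y`. -/
def DefPred (Y : Set ℕ) {α : Type} (P : (α → ℕ) → Prop) : Prop :=
  letI := arithStructure Y
  ∃ φ : arithLang.Formula α, ∀ v, P v ↔ φ.Realize v

/-- A function of assignments has a graph definable in arithmetic with oracle `Y`. -/
def DefFun (Y : Set ℕ) {α : Type} (f : (α → ℕ) → ℕ) : Prop :=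
  DefPred Y fun w : α ⊕ Fin 1 → ℕ => w (Sum.inr 0) = f fun i => w (Sum.inl i)

section Definability

variable {Y : Set ℕ} {α β : Type}

theorem DefPred.of_iff {P Q : (α → ℕ) → Prop} (h : DefPred Y P) (e : ∀ v, Q v ↔ P v) :
    DefPred Y Q := by
  obtain ⟨φ, hφ⟩ := h
  exact ⟨φ, fun v => (e v).trans (hφ v)⟩

theorem DefPred.not {P : (α → ℕ) → Prop} (h : DefPred Y P) : DefPred Y fun v => ¬ P v := by
  let _ := arithStructure Y
  obtain ⟨φ, hφ⟩ := h
  exact ⟨φ.not, fun v => by simp only [Formula.realize_not, hφ v]⟩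

theorem DefPred.and {P Q : (α → ℕ) → Prop} (h : DefPred Y P) (k : DefPred Y Q) :
    DefPred Y fun v => P v ∧ Q v := by
  let _ := arithStructure Y
  obtain ⟨φ, hφ⟩ := h
  obtain ⟨ψ, hψ⟩ := k
  exact ⟨φ ⊓ ψ, fun v => by simp only [Formula.realize_inf, hφ v, hψ v]⟩

theorem DefPred.or {P Q : (α → ℕ) → Prop} (h : DefPred Y P) (k : DefPred Y Q) :
    DefPred Y fun v => P v ∨ Q v :=
  (h.not.and k.not).not.of_iff fun v => by tauto

theorem DefPred.imp {P Q : (α → ℕ) → Prop} (h : DefPred Y P) (k : DefPred Y Q) :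
    DefPred Y fun v => P v → Q v :=
  (h.not.or k).of_iff fun v => by tauto

theorem DefPred.comap {P : (α → ℕ) → Prop} (h : DefPred Y P) (g : α → β) :
    DefPred Y fun v : β → ℕ => P fun i => v (g i) := by
  let _ := arithStructure Y
  obtain ⟨φ, hφ⟩ := h
  exact ⟨φ.relabel g, fun v => by simp only [Formula.realize_relabel, hφ]; rfl⟩

theorem DefPred.ex {P : (α → ℕ) → ℕ → Prop}
    (h : DefPred Y fun w : α ⊕ Fin 1 → ℕ => P (fun i => w (Sum.inl i)) (w (Sum.inr 0))) :
    DefPred Y fun v => ∃ m, P v m := by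
  let _ := arithStructure Y
  obtain ⟨φ, hφ⟩ := h
  refine ⟨φ.iExs (Fin 1), fun v => ?_⟩
  rw [Formula.realize_iExs]
  constructor
  · rintro ⟨m, hm⟩
    exact ⟨fun _ => m, (hφ _).1 hm⟩
  · rintro ⟨i, hi⟩
    exact ⟨i 0, (hφ _).2 hi⟩

theorem DefPred.all {P : (α → ℕ) → ℕ → Prop}
    (h : DefPred Y fun w : α ⊕ Fin 1 → ℕ => P (fun i => w (Sum.inl i)) (w (Sum.inr 0))) :
    DefPred Y fun v => ∀ m, P v m :=
  (DefPred.ex (P := fun v m => ¬ P v m) h.not).not.of_iff fun v => by simp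

theorem DefPred.subst {P : (α → ℕ) → ℕ → Prop} {f : (α → ℕ) → ℕ}
    (h : DefPred Y fun w : α ⊕ Fin 1 → ℕ => P (fun i => w (Sum.inl i)) (w (Sum.inr 0)))
    (hf : DefFun Y f) : DefPred Y fun v => P v (f v) :=
  (DefPred.ex (P := fun v m => m = f v ∧ P v m) (DefPred.and hf h)).of_iff fun v => by simp

theorem DefPred.eq_var (i j : α) : DefPred Y fun v => v i = v j := by
  let _ := arithStructure Y
  exact ⟨(Term.var i).equal (Term.var j), fun v => by simp [Formula.realize_equal]⟩

theorem DefPred.lt_var (i j : α) : DefPred Y fun v => v i < v j := by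
  let _ := arithStructure Y
  refine ⟨Relations.formula (L := arithLang) (n := 2) ArRel.lt ![Term.var i, Term.var j],
    fun v => ?_⟩
  exact (Formula.realize_rel (L := arithLang) (M := ℕ) (k := 2) (R := ArRel.lt) (v := v)
    (ts := ![Term.var i, Term.var j])).symm

theorem DefPred.mem_var (i : α) : DefPred Y fun v => v i ∈ Y := by
  let _ := arithStructure Y
  refine ⟨Relations.formula (L := arithLang) (n := 1) ArRel.mem ![Term.var i], fun v => ?_⟩
  exact (Formula.realize_rel (L := arithLang) (M := ℕ) (k := 1) (R := ArRel.mem) (v := v)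
    (ts := ![Term.var i])).symm

theorem DefFun.var (i : α) : DefFun Y fun v => v i := DefPred.eq_var _ _

theorem DefFun.of_term (t : arithLang.Term α) :
    DefFun Y fun v => letI := arithStructure Y; t.realize v := by
  let _ := arithStructure Y
  refine ⟨(Term.var (Sum.inr 0)).equal (t.relabel Sum.inl), fun v => ?_⟩
  rw [Formula.realize_equal, Term.realize_relabel]
  rfl

theorem DefFun.comap {f : (α → ℕ) → ℕ} (h : DefFun Y f) (g : α → β) :
    DefFun Y fun v : β → ℕ => f fun i => v (g i) :=
  DefPred.comap h (Sum.map g id)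

theorem DefFun.comp₁ {F : ℕ → ℕ} (hF : DefFun Y fun v : Fin 1 → ℕ => F (v 0))
    {f : (α → ℕ) → ℕ} (hf : DefFun Y f) : DefFun Y fun v => F (f v) := by
  refine DefPred.subst (P := fun w : α ⊕ Fin 1 → ℕ => fun m => w (Sum.inr 0) = F m) ?_
    (hf.comap Sum.inl)
  exact DefPred.comap hF
    (Sum.elim (fun _ => Sum.inr 0) (fun _ => Sum.inl (Sum.inr 0)) :
      Fin 1 ⊕ Fin 1 → (α ⊕ Fin 1) ⊕ Fin 1)

theorem DefPred.comp₂ {R : ℕ → ℕ → Prop} (hR : DefPred Y fun v : Fin 2 → ℕ => R (v 0) (v 1))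
    {f g : (α → ℕ) → ℕ} (hf : DefFun Y f) (hg : DefFun Y g) :
    DefPred Y fun v => R (f v) (g v) := by
  refine DefPred.subst (P := fun v m => R m (g v)) ?_ hf
  refine DefPred.subst (P := fun (w : α ⊕ Fin 1 → ℕ) m => R (w (Sum.inr 0)) m) ?_
    (hg.comap Sum.inl)
  exact hR.comap ![Sum.inl (Sum.inr 0), Sum.inr 0]

theorem DefFun.comp₂ {F : ℕ → ℕ → ℕ} (hF : DefFun Y fun v : Fin 2 → ℕ => F (v 0) (v 1))
    {f g : (α → ℕ) → ℕ} (hf : DefFun Y f) (hg : DefFun Y g) :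
    DefFun Y fun v => F (f v) (g v) := by
  refine DefPred.subst (P := fun (w : α ⊕ Fin 1 → ℕ) m =>
    w (Sum.inr 0) = F m (g fun i => w (Sum.inl i))) ?_ (hf.comap Sum.inl)
  refine DefPred.subst (P := fun (w : (α ⊕ Fin 1) ⊕ Fin 1 → ℕ) m =>
    w (Sum.inl (Sum.inr 0)) = F (w (Sum.inr 0)) m) ?_ ((hg.comap Sum.inl).comap Sum.inl)
  exact DefPred.comap hF
    (Sum.elim ![Sum.inl (Sum.inr 0), Sum.inr 0] (fun _ => Sum.inl (Sum.inl (Sum.inr 0))) :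
      Fin 2 ⊕ Fin 1 → ((α ⊕ Fin 1) ⊕ Fin 1) ⊕ Fin 1)

theorem DefPred.eq {f g : (α → ℕ) → ℕ} (hf : DefFun Y f) (hg : DefFun Y g) :
    DefPred Y fun v => f v = g v :=
  DefPred.comp₂ (DefPred.eq_var _ _) hf hg

theorem DefPred.lt {f g : (α → ℕ) → ℕ} (hf : DefFun Y f) (hg : DefFun Y g) :
    DefPred Y fun v => f v < g v :=
  DefPred.comp₂ (DefPred.lt_var _ _) hf hg

theorem DefFun.zero : DefFun Y fun _ : α → ℕ => 0 :=
  DefFun.of_term (Term.func (L := arithLang) (l := 0) ArFunc.zero ![])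

theorem DefFun.one : DefFun Y fun _ : α → ℕ => 1 :=
  DefFun.of_term (Term.func (L := arithLang) (l := 0) ArFunc.one ![])

theorem DefFun.add {f g : (α → ℕ) → ℕ} (hf : DefFun Y f) (hg : DefFun Y g) :
    DefFun Y fun v => f v + g v :=
  DefFun.comp₂ (F := fun a b => a + b) (DefFun.of_term
    (Functions.apply₂ (L := arithLang) ArFunc.add (Term.var 0) (Term.var 1))) hf hg

theorem DefFun.mul {f g : (α → ℕ) → ℕ} (hf : DefFun Y f) (hg : DefFun Y g) :
    DefFun Y fun v => f v * g v :=
  DefFun.comp₂ (F := fun a b => a * b) (DefFun.of_term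
    (Functions.apply₂ (L := arithLang) ArFunc.mul (Term.var 0) (Term.var 1))) hf hg

theorem DefFun.pair {f g : (α → ℕ) → ℕ} (hf : DefFun Y f) (hg : DefFun Y g) :
    DefFun Y fun v => Nat.pair (f v) (g v) := by
  refine DefFun.comp₂ (F := Nat.pair) ?_ hf hg
  have a : DefFun Y fun w : Fin 2 ⊕ Fin 1 → ℕ => w (Sum.inl 0) := DefFun.var _
  have b : DefFun Y fun w : Fin 2 ⊕ Fin 1 → ℕ => w (Sum.inl 1) := DefFun.var _
  have c : DefFun Y fun w : Fin 2 ⊕ Fin 1 → ℕ => w (Sum.inr 0) := DefFun.var _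
  refine (((DefPred.lt a b).and (DefPred.eq c ((b.mul b).add a))).or
    ((DefPred.lt a b).not.and (DefPred.eq c (((a.mul a).add a).add b)))).of_iff fun w => ?_
  simp only [Nat.pair]
  split_ifs with h <;> simp [h]

theorem DefFun.unpair_fst {f : (α → ℕ) → ℕ} (hf : DefFun Y f) :
    DefFun Y fun v => (Nat.unpair (f v)).1 := by
  refine DefFun.comp₁ (F := fun n => (Nat.unpair n).1) ?_ hf
  refine (DefPred.ex (P := fun (w : Fin 1 ⊕ Fin 1 → ℕ) m =>
    w (Sum.inl 0) = Nat.pair (w (Sum.inr 0)) m)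
    (DefPred.eq (DefFun.var _) ((DefFun.var _).pair (DefFun.var _)))).of_iff fun w => ?_
  constructor
  · intro h
    exact ⟨(Nat.unpair (w (Sum.inl 0))).2, by rw [h, Nat.pair_unpair]⟩
  · rintro ⟨m, hm⟩
    simp [hm]

theorem DefFun.unpair_snd {f : (α → ℕ) → ℕ} (hf : DefFun Y f) :
    DefFun Y fun v => (Nat.unpair (f v)).2 := by
  refine DefFun.comp₁ (F := fun n => (Nat.unpair n).2) ?_ hf
  refine (DefPred.ex (P := fun (w : Fin 1 ⊕ Fin 1 → ℕ) m =>
    w (Sum.inl 0) = Nat.pair m (w (Sum.inr 0)))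
    (DefPred.eq (DefFun.var _) ((DefFun.var _).pair (DefFun.var _)))).of_iff fun w => ?_
  constructor
  · intro h
    exact ⟨(Nat.unpair (w (Sum.inl 0))).1, by rw [h, Nat.pair_unpair]⟩
  · rintro ⟨m, hm⟩
    simp [hm]

theorem DefFun.mod_succ {f g : (α → ℕ) → ℕ} (hf : DefFun Y f) (hg : DefFun Y g) :
    DefFun Y fun v => f v % (g v + 1) := by
  refine DefFun.comp₂ (F := fun a b => a % (b + 1)) ?_ hf hg
  refine ((DefPred.lt (DefFun.var (Sum.inr 0)) ((DefFun.var (Sum.inl 1)).add .one)).and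
    (DefPred.ex (P := fun (w : Fin 2 ⊕ Fin 1 → ℕ) q =>
      w (Sum.inl 0) = (w (Sum.inl 1) + 1) * q + w (Sum.inr 0))
    (DefPred.eq (DefFun.var _) ((((DefFun.var _).add .one).mul (DefFun.var _)).add
      (DefFun.var _))))).of_iff fun w => ?_
  constructor
  · intro h
    refine ⟨h ▸ Nat.mod_lt _ (Nat.succ_pos _), w (Sum.inl 0) / (w (Sum.inl 1) + 1), ?_⟩
    rw [h, Nat.div_add_mod]
  · rintro ⟨h, q, hq⟩
    simp only [hq, Nat.mul_add_mod, Nat.mod_eq_of_lt h]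

theorem DefFun.beta {f g : (α → ℕ) → ℕ} (hf : DefFun Y f) (hg : DefFun Y g) :
    DefFun Y fun v => Nat.beta (f v) (g v) :=
  hf.unpair_fst.mod_succ ((hg.add .one).mul hf.unpair_snd)

/-- The graph of a function obtained by iteration of `g` from `f`, in terms of codes of
sequences. -/
theorem rec_eq_iff_beta (f g : ℕ → ℕ) (z n y : ℕ) :
    y = (Nat.rec (f z) (fun i ih => g (Nat.pair z (Nat.pair i ih))) n : ℕ) ↔
      ∃ s, (Nat.beta s 0 = f z ∧ ∀ i, i < n →
        Nat.beta s (i + 1) = g (Nat.pair z (Nat.pair i (Nat.beta s i)))) ∧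
        y = Nat.beta s n := by
  set F : ℕ → ℕ := fun n => Nat.rec (f z) (fun i ih => g (Nat.pair z (Nat.pair i ih))) n with hF
  have hs : ∀ i, F (i + 1) = g (Nat.pair z (Nat.pair i (F i))) := fun i => rfl
  change y = F n ↔ _
  constructor
  · rintro rfl
    have key : ∀ i, i ≤ n → Nat.beta (Nat.unbeta (List.ofFn fun i : Fin (n + 1) => F i)) i = F i := by
      intro i hi
      have h := Nat.beta_unbeta_coe (List.ofFn fun i : Fin (n + 1) => F i)
        ⟨i, by rw [List.length_ofFn]; omega⟩
      exact h.trans (List.getElem_ofFn _)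
    refine ⟨_, ⟨?_, fun i hi => ?_⟩, (key n le_rfl).symm⟩
    · exact key 0 (Nat.zero_le _)
    · rw [key (i + 1) hi, key i hi.le, hs]
  · rintro ⟨s, ⟨h0, h1⟩, rfl⟩
    have key : ∀ i, i ≤ n → Nat.beta s i = F i := by
      intro i
      induction i with
      | zero => exact fun _ => h0
      | succ i ih => exact fun hi => by rw [h1 i hi, ih (Nat.le_of_succ_le hi), hs]
    exact key n le_rfl

theorem DefFun.of_primrec {F : ℕ → ℕ} (hF : Nat.Primrec F) {α : Type} {f : (α → ℕ) → ℕ}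
    (hf : DefFun Y f) : DefFun Y fun v => F (f v) := by
  induction hF generalizing α f with
  | zero => exact .zero
  | succ => exact hf.add .one
  | left => exact hf.unpair_fst
  | right => exact hf.unpair_snd
  | pair _ _ ih₁ ih₂ => exact (ih₁ hf).pair (ih₂ hf)
  | comp _ _ ih₁ ih₂ => exact ih₁ (ih₂ hf)
  | @prec f₀ g₀ _ _ ih₁ ih₂ =>
    refine DefFun.comp₂ (F := fun z n =>
      (Nat.rec (f₀ z) (fun i ih => g₀ (Nat.pair z (Nat.pair i ih))) n : ℕ)) ?_
      hf.unpair_fst hf.unpair_snd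
    have z : DefFun Y fun w : Fin 2 ⊕ Fin 1 → ℕ => w (Sum.inl 0) := DefFun.var _
    have n : DefFun Y fun w : Fin 2 ⊕ Fin 1 → ℕ => w (Sum.inl 1) := DefFun.var _
    have y : DefFun Y fun w : Fin 2 ⊕ Fin 1 → ℕ => w (Sum.inr 0) := DefFun.var _
    have s : DefFun Y fun w : (Fin 2 ⊕ Fin 1) ⊕ Fin 1 → ℕ => w (Sum.inr 0) := DefFun.var _
    refine (DefPred.ex (((DefPred.eq (s.beta .zero) (ih₁ (z.comap Sum.inl))).and
      (DefPred.all ?_)).and (DefPred.eq (y.comap Sum.inl) (s.beta (n.comap Sum.inl))))).of_iff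
      fun w => rec_eq_iff_beta f₀ g₀ _ _ _
    have i : DefFun Y fun w : ((Fin 2 ⊕ Fin 1) ⊕ Fin 1) ⊕ Fin 1 → ℕ => w (Sum.inr 0) :=
      DefFun.var _
    exact (DefPred.lt i ((n.comap Sum.inl).comap Sum.inl)).imp
      (DefPred.eq ((s.comap Sum.inl).beta (i.add .one))
        (ih₂ (((z.comap Sum.inl).comap Sum.inl).pair (i.pair ((s.comap Sum.inl).beta i)))))

end Definability

/-- A predicate on a primitively codable type is arithmetical in `Y`. -/
def ArPred (Y : Set ℕ) {α : Type} [Primcodable α] (P : α → Prop) : Prop :=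
  ∃ Q : ℕ → Prop, (DefPred Y fun v : Fin 1 → ℕ => Q (v 0)) ∧
    ∀ a, P a ↔ Q (Encodable.encode a)

theorem arReducible_iff_arPred {X Y : Set ℕ} : ArReducible X Y ↔ ArPred Y fun n => n ∈ X := by
  have e : ∀ v : Fin 1 → ℕ, v = fun _ => v 0 := fun v => funext fun i => by
    rw [Subsingleton.elim i 0]
  constructor
  · rintro ⟨φ, rfl⟩
    refine ⟨_, ⟨φ, fun v => ?_⟩, fun a => Iff.rfl⟩
    conv_rhs => rw [e v]
    exact Iff.rfl
  · rintro ⟨Q, ⟨φ, hφ⟩, hQ⟩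
    exact ⟨φ, Set.ext fun n => (hQ n).trans (hφ fun _ => n)⟩

section ArPred

variable {Y : Set ℕ} {α β γ : Type} [Primcodable α] [Primcodable β] [Primcodable γ]

theorem ArPred.of_iff {P Q : α → Prop} (h : ArPred Y P) (e : ∀ a, Q a ↔ P a) : ArPred Y Q := by
  rwa [show Q = P from funext fun a => propext (e a)]

theorem ArPred.not {P : α → Prop} (h : ArPred Y P) : ArPred Y fun a => ¬ P a := by
  obtain ⟨Q, hQ, e⟩ := h
  exact ⟨fun n => ¬ Q n, hQ.not, fun a => not_congr (e a)⟩

theorem ArPred.and {P Q : α → Prop} (h : ArPred Y P) (k : ArPred Y Q) :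
    ArPred Y fun a => P a ∧ Q a := by
  obtain ⟨P', hP, e⟩ := h
  obtain ⟨Q', hQ, e'⟩ := k
  exact ⟨fun n => P' n ∧ Q' n, hP.and hQ, fun a => and_congr (e a) (e' a)⟩

theorem ArPred.or {P Q : α → Prop} (h : ArPred Y P) (k : ArPred Y Q) :
    ArPred Y fun a => P a ∨ Q a :=
  (h.not.and k.not).not.of_iff fun v => by tauto

theorem ArPred.imp {P Q : α → Prop} (h : ArPred Y P) (k : ArPred Y Q) :
    ArPred Y fun a => P a → Q a :=
  (h.not.or k).of_iff fun v => by tauto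

theorem ArPred.iff {P Q : α → Prop} (h : ArPred Y P) (k : ArPred Y Q) :
    ArPred Y fun a => P a ↔ Q a :=
  ((h.imp k).and (k.imp h)).of_iff fun v => by tauto

theorem ArPred.comp {P : β → Prop} (h : ArPred Y P) {f : α → β} (hf : Primrec f) :
    ArPred Y fun a => P (f a) := by
  obtain ⟨Q, hQ, e⟩ := h
  refine ⟨fun n => Q (Nat.pred (Encodable.encode ((Encodable.decode (α := α) n).map f))), ?_,
    fun a => ?_⟩
  · refine DefPred.subst (P := fun _ m => Q m) (f := fun v : Fin 1 → ℕ => Nat.pred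
      (Encodable.encode ((Encodable.decode (α := α) (v 0)).map f))) ?_ ?_
    · exact hQ.comap fun _ => Sum.inr 0
    · exact DefFun.of_primrec (Primrec.nat_iff.1 Primrec.pred)
        (DefFun.of_primrec hf (DefFun.var 0))
  · simp only [Encodable.encodek]
    exact e (f a)

theorem ArPred.ex {P : α → β → Prop} (h : ArPred Y fun p : α × β => P p.1 p.2) :
    ArPred Y fun a => ∃ b, P a b := by
  obtain ⟨Q, hQ, e⟩ := h
  refine ⟨fun n => ∃ m, ¬ Encodable.encode (Encodable.decode (α := β) m) = 0 ∧
    Q (Nat.pair n (Nat.pred (Encodable.encode (Encodable.decode (α := β) m)))), ?_, fun a => ?_⟩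
  · have hd : DefFun Y fun w : Fin 1 ⊕ Fin 1 → ℕ =>
        Encodable.encode (Encodable.decode (α := β) (w (Sum.inr 0))) :=
      DefFun.of_primrec (Primcodable.prim β) (DefFun.var _)
    refine DefPred.ex ((DefPred.eq hd .zero).not.and ?_)
    refine DefPred.subst (P := fun _ m => Q m) (hQ.comap fun _ => Sum.inr 0)
      (DefFun.pair (DefFun.var _) ?_)
    exact DefFun.of_primrec (Primrec.nat_iff.1 Primrec.pred) hd
  · constructor
    · rintro ⟨b, hb⟩
      refine ⟨Encodable.encode b, ?_, ?_⟩
      · simp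
      · simpa using (e (a, b)).1 hb
    · rintro ⟨m, hm, hq⟩
      cases hdec : Encodable.decode (α := β) m with
      | none => simp [hdec] at hm
      | some b =>
        refine ⟨b, (e (a, b)).2 ?_⟩
        simpa [hdec] using hq

theorem ArPred.all {P : α → β → Prop} (h : ArPred Y fun p : α × β => P p.1 p.2) :
    ArPred Y fun a => ∀ b, P a b :=
  (ArPred.ex (P := fun a b => ¬ P a b) h.not).not.of_iff fun a => by simp

theorem ArPred.of_primrecPred {P : α → Prop} (h : PrimrecPred P) : ArPred Y P := by
  obtain ⟨_, h⟩ := h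
  have hb : ArPred Y fun b : Bool => b = true :=
    ⟨fun n => n = 1, DefPred.eq (DefFun.var 0) .one, by decide⟩
  exact (hb.comp h).of_iff fun a => by simp

theorem ArPred.eq {f g : α → β} (hf : Primrec f) (hg : Primrec g) :
    ArPred Y fun a => f a = g a := by
  classical
  exact .of_primrecPred (PrimrecRel.comp Primrec.eq hf hg)

theorem ArPred.lt {f g : α → ℕ} (hf : Primrec f) (hg : Primrec g) :
    ArPred Y fun a => f a < g a :=
  .of_primrecPred (PrimrecRel.comp Primrec.nat_lt hf hg)

theorem ArPred.mem_list {f : α → β} {g : α → List β} (hf : Primrec f) (hg : Primrec g) :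
    ArPred Y fun a => f a ∈ g a := by
  refine (ArPred.ex (P := fun a (i : ℕ) => (g a)[i]? = some (f a)) (ArPred.eq ?_ ?_)).of_iff
    fun a => List.mem_iff_getElem?
  · exact Primrec.list_getElem?.comp (hg.comp Primrec.fst) Primrec.snd
  · exact Primrec.option_some.comp (hf.comp Primrec.fst)

theorem ArPred.forall_mem {P : α → β → Prop} {g : α → List β}
    (h : ArPred Y fun p : α × β => P p.1 p.2) (hg : Primrec g) :
    ArPred Y fun a => ∀ b ∈ g a, P a b :=
  ArPred.all ((ArPred.mem_list Primrec.snd (hg.comp Primrec.fst)).imp h)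

theorem ArPred.exists_mem {P : α → β → Prop} {g : α → List β}
    (h : ArPred Y fun p : α × β => P p.1 p.2) (hg : Primrec g) :
    ArPred Y fun a => ∃ b ∈ g a, P a b :=
  ArPred.ex ((ArPred.mem_list Primrec.snd (hg.comp Primrec.fst)).and h)

theorem ArPred.mem_set {X : Set ℕ} (h : ArReducible X Y) {f : α → ℕ} (hf : Primrec f) :
    ArPred Y fun a => f a ∈ X :=
  (arReducible_iff_arPred.1 h).comp hf

theorem ArReducible.refl (Y : Set ℕ) : ArReducible Y Y :=
  arReducible_iff_arPred.2 ⟨fun n => n ∈ Y, DefPred.mem_var 0, fun _ => Iff.rfl⟩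

theorem primrec_realize_term (Y : Set ℕ) {δ : Type} {h : α → δ → ℕ}
    (hh : ∀ i, Primrec fun a => h a i) (t : arithLang.Term δ) :
    Primrec fun a => letI := arithStructure Y; t.realize (h a) := by
  induction t with
  | var i => exact hh i
  | func f ts ih =>
    cases f with
    | zero => exact Primrec.const 0
    | one => exact Primrec.const 1
    | add => exact Primrec.nat_add.comp (ih 0) (ih 1)
    | mul => exact Primrec.nat_mul.comp (ih 0) (ih 1)

theorem arPred_realize {Y Z : Set ℕ} (hY : ArReducible Y Z) {n : ℕ}
    (φ : arithLang.BoundedFormula (Fin 1) n) :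
    ArPred Z fun l : List ℕ => letI := arithStructure Y
      φ.Realize (fun _ => l.getD n 0) (fun i => l.getD (n - 1 - i) 0) := by
  have hv : ∀ n : ℕ, ∀ i : Fin 1 ⊕ Fin n, Primrec fun l : List ℕ =>
      (Sum.elim (fun _ => l.getD n 0) (fun i => l.getD (n - 1 - i) 0) : Fin 1 ⊕ Fin n → ℕ) i := by
    rintro n (i | i)
    · exact (Primrec.list_getD 0).comp .id (.const _)
    · exact (Primrec.list_getD 0).comp .id (.const _)
  induction φ with
  | falsum =>
    exact .of_primrecPred (PrimrecPred.of_eq (Primrec.eq.comp (.const 0) (.const 1))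
      fun l => by simp [BoundedFormula.Realize])
  | equal t₁ t₂ =>
    exact ArPred.eq (primrec_realize_term Y (hv _) t₁) (primrec_realize_term Y (hv _) t₂)
  | rel R ts =>
    cases R with
    | lt =>
      exact ArPred.lt (primrec_realize_term Y (hv _) (ts 0))
        (primrec_realize_term Y (hv _) (ts 1))
    | mem =>
      exact ArPred.mem_set hY (primrec_realize_term Y (hv _) (ts 0))
  | imp _ _ ih₁ ih₂ => exact ih₁.imp ih₂
  | @all n φ ih =>
    refine (ArPred.all (P := fun (l : List ℕ) (m : ℕ) => letI := arithStructure Y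
      φ.Realize (fun _ => (m :: l).getD (n + 1) 0) (fun i => (m :: l).getD (n + 1 - 1 - i) 0))
      (ih.comp (Primrec.list_cons.comp .snd .fst))).of_iff fun l => ?_
    refine forall_congr' fun m => ?_
    have : (Fin.snoc (fun i : Fin n => l.getD (n - 1 - i) 0) m : Fin (n + 1) → ℕ) =
        fun i : Fin (n + 1) => (m :: l).getD (n + 1 - 1 - i) 0 := by
      funext i
      refine Fin.lastCases ?_ (fun j => ?_) i
      · simp
      · have hj := j.2
        rw [Fin.snoc_castSucc]
        obtain ⟨k, hk⟩ : ∃ k, n + 1 - 1 - (j.castSucc : ℕ) = k + 1 :=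
          ⟨n - 1 - j, by simp; omega⟩
        rw [hk, List.getD_cons_succ]
        congr 1
        simp at hk
        omega
    rw [this]
    exact Iff.rfl

theorem ArReducible.trans {X Y Z : Set ℕ} (h : ArReducible X Y) (k : ArReducible Y Z) :
    ArReducible X Z := by
  obtain ⟨φ, rfl⟩ := h
  refine arReducible_iff_arPred.2 (((arPred_realize k φ).comp
    (f := fun n : ℕ => [n]) (Primrec.list_cons.comp .id (.const []))).of_iff fun n => ?_)
  simp only [Set.mem_ofPred_eq, Formula.Realize]
  refine iff_of_eq (congrArg _ (Subsingleton.elim _ _))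

theorem ArReducible.of_isArithmetical {X : Set ℕ} (h : IsArithmetical X) (Y : Set ℕ) :
    ArReducible X Y :=
  ArReducible.trans h (arReducible_iff_arPred.2
    (.of_primrecPred (PrimrecPred.of_eq (Primrec.eq.comp (.const 0) (.const 1)) fun l => by simp)))

theorem isArithmetical_of_finite {X : Set ℕ} (h : X.Finite) : IsArithmetical X := by
  obtain ⟨l, hl⟩ : ∃ l : List ℕ, ∀ x, x ∈ X ↔ x ∈ l :=
    ⟨h.toFinset.toList, fun x => by simp⟩
  exact arReducible_iff_arPred.2 ((ArPred.mem_list .id (.const l)).of_iff hl)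

end ArPred

section SameType

variable {M N P : Type} [L.Structure M] [L.Structure N] [L.Structure P] {α β : Type}

variable (L) in
/-- Two families, possibly in different structures, satisfy the same formulas. -/
def SameType (a : α → M) (b : α → N) : Prop := ∀ φ : L.Formula α, φ.Realize a ↔ φ.Realize b

theorem SameType.symm {a : α → M} {b : α → N} (h : SameType L a b) : SameType L b a :=
  fun φ => (h φ).symm

theorem SameType.trans {a : α → M} {b : α → N} {c : α → P} (h : SameType L a b)
    (k : SameType L b c) : SameType L a c :=
  fun φ => (h φ).trans (k φ)

theorem SameType.comp {a : α → M} {b : α → N} (h : SameType L a b) (f : β → α) :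
    SameType L (a ∘ f) (b ∘ f) := fun φ => by
  rw [← Formula.realize_relabel, ← Formula.realize_relabel]
  exact h _

theorem exists_fin_restrict (φ : L.Formula α) :
    ∃ (m : ℕ) (c : Fin m → α) (ψ : L.Formula (Fin m)), ∀ (M : Type) [L.Structure M] (v : α → M),
      φ.Realize v ↔ ψ.Realize (v ∘ c) := by
  classical
  let e := φ.freeVarFinset.equivFin
  exact ⟨_, fun i => (e.symm i : α), φ.restrictFreeVar e, fun M _ v =>
    (BoundedFormula.realize_restrictFreeVar v (by simp)).symm⟩

theorem exists_fin_restrict_cons [Nonempty α] (φ : L.Formula (α ⊕ Fin 1)) :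
    ∃ (m : ℕ) (c : Fin m → α) (ψ : L.Formula (Fin (m + 1))),
      ∀ (M : Type) [L.Structure M] (a : α → M) (x : M),
        φ.Realize (Sum.elim a fun _ => x) ↔ ψ.Realize (Fin.cons x (a ∘ c) : Fin (m + 1) → M) := by
  obtain ⟨m, c, ψ, h⟩ := exists_fin_restrict φ
  obtain ⟨z⟩ := ‹Nonempty α›
  refine ⟨m, fun i => Sum.elim id (fun _ => z) (c i),
    ψ.relabel fun i => Sum.elim (fun _ => i.succ) (fun _ => 0) (c i), fun M _ a x => ?_⟩
  rw [h, Formula.realize_relabel]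
  refine iff_of_eq (congrArg _ (funext fun i => ?_))
  rcases hc : c i with j | j <;> simp [hc]

theorem natCast_le_encard_iff {s : Set M} {m : ℕ} :
    (m : ℕ∞) ≤ s.encard ↔ ∃ f : Fin m → M, (∀ i, f i ∈ s) ∧ Function.Injective f := by
  constructor
  · intro h
    obtain ⟨t, ht, e⟩ := Set.exists_subset_encard_eq h
    have hfin : t.Finite := Set.finite_of_encard_eq_coe e
    have hcard : Nat.card t = m := by
      rw [Nat.card_coe_set_eq, Set.ncard, e, ENat.toNat_natCast]
    have := hfin.to_subtype
    let E := Finite.equivFinOfCardEq hcard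
    exact ⟨fun i => (E.symm i : M), fun i => ht (E.symm i).2,
      Subtype.val_injective.comp E.symm.injective⟩
  · rintro ⟨f, hf, hi⟩
    calc (m : ℕ∞) = (Set.range f).encard := by
          rw [← Set.image_univ, hi.encard_image, Set.encard_univ, ENat.card_eq_coe_fintype_card,
            Fintype.card_fin]
      _ ≤ s.encard := Set.encard_le_encard (Set.range_subset_iff.2 hf)

/-- The elements of `M` satisfying `φ(a, ·)`. -/
def solutions (φ : L.Formula (α ⊕ Fin 1)) (a : α → M) : Set M :=
  { z | φ.Realize (Sum.elim a fun _ => z) }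

theorem SameType.encard_solutions_eq {a : α → M} {b : α → N} (h : SameType L a b)
    (φ : L.Formula (α ⊕ Fin 1)) : (solutions φ a).encard = (solutions φ b).encard := by
  refine ENat.eq_of_forall_natCast_le_iff fun m => ?_
  let χ : L.Formula (α ⊕ Fin m) :=
    (Formula.iInf fun i : Fin m => φ.relabel (Sum.map id fun _ => i)) ⊓
    Formula.iInf fun p : { p : Fin m × Fin m // p.1 ≠ p.2 } =>
      ∼(Term.equal (Term.var (Sum.inr p.1.1)) (Term.var (Sum.inr p.1.2)))
  have key : ∀ (Q : Type) [L.Structure Q] (c : α → Q),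
      ((χ.iExs (Fin m)).Realize c ↔ (m : ℕ∞) ≤ (solutions φ c).encard) := by
    intro Q _ c
    rw [natCast_le_encard_iff, Formula.realize_iExs]
    refine exists_congr fun f => ?_
    rw [Formula.realize_inf, Formula.realize_iInf, Formula.realize_iInf]
    refine and_congr (forall_congr' fun i => ?_) ⟨fun k i j e => ?_, fun k p => ?_⟩
    · rw [Formula.realize_relabel]
      refine iff_of_eq (congrArg _ (funext fun j => ?_))
      rcases j with j | j <;> rfl
    · by_contra hij
      have := k ⟨(i, j), hij⟩
      rw [Formula.realize_not, Formula.realize_equal] at this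
      exact this e
    · rw [Formula.realize_not, Formula.realize_equal]
      exact fun e => p.2 (k e)
  rw [← key, ← key]
  exact h _

theorem SameType.finite_solutions_iff {a : α → M} {b : α → N} (h : SameType L a b)
    (φ : L.Formula (α ⊕ Fin 1)) : (solutions φ a).Finite ↔ (solutions φ b).Finite := by
  rw [← Set.encard_lt_top_iff, ← Set.encard_lt_top_iff, h.encard_solutions_eq]

theorem solutions_not (φ : L.Formula (α ⊕ Fin 1)) (a : α → M) :
    solutions (∼φ) a = (solutions φ a)ᶜ := by
  ext z
  exact Formula.realize_not

theorem solutions_inf (φ ψ : L.Formula (α ⊕ Fin 1)) (a : α → M) :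
    solutions (φ ⊓ ψ) a = solutions φ a ∩ solutions ψ a := by
  ext z
  exact Formula.realize_inf

variable (L) in
/-- `y` satisfies no formula over the range of `b` with finitely many solutions. -/
def Nonalgebraic (b : α → N) (y : N) : Prop :=
  ∀ φ : L.Formula (α ⊕ Fin 1), y ∈ solutions φ b → (solutions φ b).Infinite

theorem SameType.exists_extend {a : α → M} {b : α → N} (h : SameType L a b)
    (hmin : ∀ φ : L.Formula (α ⊕ Fin 1), (solutions φ a).Finite ∨ (solutions φ a)ᶜ.Finite)
    (hy : ∃ y : N, Nonalgebraic L b y) (x : M) :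
    ∃ y : N, SameType L (Sum.elim a fun _ : Fin 1 => x) (Sum.elim b fun _ : Fin 1 => y) := by
  suffices ∃ y : N, ∀ φ : L.Formula (α ⊕ Fin 1), x ∈ solutions φ a → y ∈ solutions φ b by
    obtain ⟨y, hy⟩ := this
    refine ⟨y, fun φ => ⟨hy φ, fun k => ?_⟩⟩
    by_contra hx
    exact Formula.realize_not.1 (hy (∼φ) (Formula.realize_not.2 hx)) k
  by_cases hx : Nonalgebraic L a x
  · obtain ⟨y, hy⟩ := hy
    refine ⟨y, fun φ hφ => ?_⟩
    have hfin : (solutions (∼φ) b).Finite := by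
      rw [← h.finite_solutions_iff, solutions_not]
      exact (hmin φ).resolve_left (hx φ hφ)
    by_contra k
    exact hy (∼φ) (Formula.realize_not.2 k) hfin
  · obtain ⟨χ, hχ, hfin⟩ : ∃ φ : L.Formula (α ⊕ Fin 1),
        x ∈ solutions φ a ∧ (solutions φ a).Finite := by
      simpa [Nonalgebraic] using hx
    obtain ⟨φ, hφ, hle⟩ := (InvImage.wf (fun φ : L.Formula (α ⊕ Fin 1) => (solutions φ a).encard)
      wellFounded_lt).has_min { φ | x ∈ solutions φ a } ⟨χ, hχ⟩
    have hφfin : (solutions φ a).Finite := Set.encard_lt_top_iff.1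
      ((not_lt.1 (hle χ hχ)).trans_lt (Set.encard_lt_top_iff.2 hfin))
    obtain ⟨y, hy⟩ : (solutions φ b).Nonempty := by
      rw [← Set.one_le_encard_iff_nonempty, ← h.encard_solutions_eq,
        Set.one_le_encard_iff_nonempty]
      exact ⟨x, hφ⟩
    refine ⟨y, fun ψ hψ => ?_⟩
    have heq : solutions (φ ⊓ ψ) a = solutions φ a := by
      have hmem : x ∈ solutions (φ ⊓ ψ) a := solutions_inf φ ψ a ▸ ⟨hφ, hψ⟩
      have hsub : solutions (φ ⊓ ψ) a ⊆ solutions φ a := by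
        rw [solutions_inf]
        exact Set.inter_subset_left
      exact (hφfin.subset hsub).eq_of_subset_of_encard_le hsub (not_lt.1 (hle (φ ⊓ ψ) hmem))
    have hempty : solutions (φ ⊓ ∼ψ) b = ∅ := by
      rw [← Set.encard_eq_zero, ← h.encard_solutions_eq, Set.encard_eq_zero, solutions_inf,
        solutions_not, ← heq, solutions_inf, Set.inter_assoc, Set.inter_compl_self,
        Set.inter_empty]
    by_contra k
    exact (hempty ▸ (solutions_inf φ (∼ψ) b ▸ ⟨hy, Formula.realize_not.2 k⟩ :
      y ∈ solutions (φ ⊓ ∼ψ) b) : y ∈ (∅ : Set N))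

end SameType

attribute [instance] CodedStructure.struc

section Codes

theorem termCode_injective (g : GoedelCoding L) {α : Type} {e : α → ℕ} (he : e.Injective) :
    (termCode g e).Injective := by
  refine Encodable.encode_injective.comp ((List.map_injective_iff.2 ?_).comp ?_)
  · rintro (a | ⟨n, f⟩) (b | ⟨m, f'⟩) h
    · simpa [he.eq_iff] using h
    · simp at h
    · simp at h
    · simp only [Sum.elim_inr, Nat.pair_eq_pair, true_and] at h
      obtain ⟨rfl, h⟩ := h
      rw [g.encFun_inj n h]
  · exact Term.listEncode_injective

theorem formulaCode_injective (g : GoedelCoding L) {α : Type} {e : α → ℕ} (he : e.Injective)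
    {n : ℕ} : (formulaCode g e : L.BoundedFormula α n → ℕ).Injective := by
  have hv : ∀ k, (Sum.elim (fun a => Nat.pair 0 (e a)) fun i : Fin k => Nat.pair 1 i.1).Injective := by
    rintro k (a | i) (b | j) h
    · simpa [he.eq_iff] using h
    · simp at h
    · simp at h
    · simpa [Fin.ext_iff] using h
  refine Encodable.encode_injective.comp ((List.map_injective_iff.2 ?_).comp ?_)
  · rintro (⟨n, t⟩ | ⟨n, r⟩ | m) (⟨n', t'⟩ | ⟨n', r'⟩ | m') h <;>
      simp at h
    · obtain ⟨rfl, h⟩ := h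
      rw [termCode_injective g (hv n) h]
    · obtain ⟨rfl, h⟩ := h
      rw [g.encRel_inj n h]
    · rw [h]
  · intro φ ψ h
    have := BoundedFormula.listEncode_sigma_injective
      (a₁ := (⟨n, φ⟩ : Σ n, L.BoundedFormula α n)) (a₂ := ⟨n, ψ⟩) h
    simpa using this

theorem tupleCode_injective {n : ℕ} : (tupleCode : (Fin n → ℕ) → ℕ).Injective :=
  Encodable.encode_injective.comp List.ofFn_injective

variable {g : GoedelCoding L} {M N : CodedStructure L} {α : Type}

/-- The code of a formula in `k` variables together with `k`. -/
def sizedCode (g : GoedelCoding L) {k : ℕ} (φ : L.Formula (Fin k)) : ℕ :=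
  Nat.pair k (formulaCode g Fin.val φ)

theorem mem_elemDiagram {k : ℕ} {φ : L.Formula (Fin k)} {a : Fin k → M.carrier} :
    Nat.pair (sizedCode g φ) (Encodable.encode (List.ofFn fun i => (a i : ℕ))) ∈ elemDiagram g M ↔
      φ.Realize a := by
  constructor
  · rintro ⟨k', φ', a', e, h⟩
    simp only [sizedCode, Nat.pair_eq_pair] at e
    obtain ⟨⟨rfl, e⟩, e'⟩ := e
    have e' := tupleCode_injective e'
    rw [formulaCode_injective g Fin.val_injective e,
      show a = a' from funext fun i => Subtype.ext (congrFun e' i)]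
    exact h
  · exact fun h => ⟨k, φ, a, rfl, h⟩

theorem exists_of_mem_elemDiagram {c : ℕ} {l : List ℕ}
    (h : Nat.pair c (Encodable.encode l) ∈ elemDiagram g M) :
    ∃ (k : ℕ) (φ : L.Formula (Fin k)) (a : Fin k → M.carrier), c = sizedCode g φ ∧
      l = List.ofFn (fun i => (a i : ℕ)) ∧ φ.Realize a := by
  obtain ⟨k, φ, a, e, h⟩ := h
  simp only [Nat.pair_eq_pair] at e
  exact ⟨k, φ, a, e.1, Encodable.encode_injective e.2, h⟩

theorem mem_carrier_iff {x : ℕ} : x ∈ M.carrier ↔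
    Nat.pair (sizedCode g (⊤ : L.Formula (Fin 1))) (Encodable.encode [x]) ∈ elemDiagram g M := by
  constructor
  · intro h
    exact (mem_elemDiagram (a := fun _ => ⟨x, h⟩)).2 (Formula.realize_top.2 trivial)
  · intro h
    obtain ⟨k, φ, a, -, e, -⟩ := exists_of_mem_elemDiagram h
    have : x ∈ List.ofFn fun i => (a i : ℕ) := e ▸ List.mem_singleton_self x
    obtain ⟨i, rfl⟩ := (List.mem_ofFn' _ _).1 this
    exact (a i).2

theorem ArithDecidable.isArithmetical_carrier (h : ArithDecidable g M) :
    IsArithmetical M.carrier :=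
  arReducible_iff_arPred.2 <| (ArPred.mem_set h <| Primrec₂.natPair.comp (Primrec.const _)
    (Primrec.encode.comp (Primrec.list_cons.comp Primrec.id (Primrec.const [])))).of_iff
      fun _ => mem_carrier_iff

/-- The inclusion of an elementary substructure. -/
def ElemSub.incl (h : ElemSub M N) : M.carrier → N.carrier := Set.inclusion h.subset

theorem ElemSub.sameType (h : ElemSub M N) (a : α → M.carrier) :
    SameType L a (h.incl ∘ a) := fun φ => by
  obtain ⟨m, c, ψ, hψ⟩ := exists_fin_restrict φ
  rw [hψ, hψ]
  exact h.elem m ψ _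

end Codes

theorem exists_eq_ofFn_comp {α β : Type} {f : α → β} {q : List β} (h : ∀ x ∈ q, ∃ i, f i = x) :
    ∃ (n : ℕ) (c : Fin n → α), q = List.ofFn (f ∘ c) := by
  obtain ⟨l, rfl⟩ : q ∈ Set.range (List.map f) := Set.range_list_map f ▸ h
  exact ⟨l.length, l.get, by rw [← List.map_ofFn, List.ofFn_get]⟩

theorem forall_mem_ofFn_comp {α β : Type} {f : α → β} {n : ℕ} {c : Fin n → α} {x : β}
    (h : x ∈ List.ofFn (f ∘ c)) : ∃ i, f i = x := by
  obtain ⟨i, rfl⟩ := (List.mem_ofFn' _ _).1 h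
  exact ⟨c i, rfl⟩

section Algebraic

variable {g : GoedelCoding L} {T : L.Theory} {M N : CodedStructure L} {α : Type}

theorem mem_elemDiagram_ofFn {k : ℕ} {c : ℕ} {a : Fin k → M.carrier} :
    Nat.pair c (Encodable.encode (List.ofFn fun i => (a i : ℕ))) ∈ elemDiagram g M ↔
      ∃ φ : L.Formula (Fin k), c = sizedCode g φ ∧ φ.Realize a := by
  constructor
  · intro h
    obtain ⟨k', φ, a', rfl, e, h⟩ := exists_of_mem_elemDiagram h
    obtain rfl : k = k' := by simpa using congrArg List.length e
    have e := List.ofFn_injective e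
    rw [show a = a' from funext fun i => Subtype.ext (congrFun e i)]
    exact ⟨φ, rfl, h⟩
  · rintro ⟨φ, rfl, h⟩
    exact mem_elemDiagram.2 h

theorem cons_mem_elemDiagram {k : ℕ} {c z : ℕ} {a : Fin k → M.carrier} :
    Nat.pair c (Encodable.encode (z :: List.ofFn fun i => (a i : ℕ))) ∈ elemDiagram g M ↔
      ∃ φ : L.Formula (Fin (k + 1)), c = sizedCode g φ ∧
        ∃ y : M.carrier, (y : ℕ) = z ∧ φ.Realize (Fin.cons y a : Fin (k + 1) → M.carrier) := by
  have e : ∀ y : M.carrier, ((y : ℕ) :: List.ofFn fun i => (a i : ℕ)) =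
      List.ofFn fun i => ((Fin.cons y a : Fin (k + 1) → M.carrier) i : ℕ) := fun y => by
    rw [List.ofFn_succ]
    rfl
  constructor
  · intro h
    have hz : z ∈ M.carrier := by
      obtain ⟨k', φ, a', -, e, -⟩ := exists_of_mem_elemDiagram h
      have : z ∈ List.ofFn fun i => (a' i : ℕ) := e ▸ List.mem_cons_self
      obtain ⟨i, rfl⟩ := (List.mem_ofFn' _ _).1 this
      exact (a' i).2
    obtain ⟨y, rfl⟩ : ∃ y : M.carrier, (y : ℕ) = z := ⟨⟨z, hz⟩, rfl⟩
    rw [e] at h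
    obtain ⟨φ, hc, h⟩ := mem_elemDiagram_ofFn.1 h
    exact ⟨φ, hc, y, rfl, h⟩
  · rintro ⟨φ, hc, y, rfl, h⟩
    rw [e]
    exact mem_elemDiagram_ofFn.2 ⟨φ, hc, h⟩

theorem mem_solutions_relabel {M : Type} [L.Structure M] {k : ℕ} (φ : L.Formula (Fin (k + 1)))
    (a : Fin k → M) (y : M) :
    y ∈ solutions (φ.relabel (Fin.cases (Sum.inr 0) Sum.inl : Fin (k + 1) → Fin k ⊕ Fin 1)) a ↔
      φ.Realize (Fin.cons y a : Fin (k + 1) → M) := by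
  refine Formula.realize_relabel.trans (iff_of_eq (congrArg _ (funext fun i => ?_)))
  cases i using Fin.cases <;> rfl

theorem ElemSub.incl_injective (h : ElemSub M N) : Function.Injective h.incl :=
  Set.inclusion_injective h.subset

theorem ElemSub.solutions_eq_image (h : ElemSub M N) {φ : L.Formula (α ⊕ Fin 1)}
    {a : α → M.carrier} (hfin : (solutions φ (h.incl ∘ a)).Finite) :
    solutions φ (h.incl ∘ a) = h.incl '' solutions φ a := by
  have hst := h.sameType a
  refine (Set.Finite.eq_of_subset_of_encard_le
    (Set.Finite.image _ ((hst.finite_solutions_iff φ).2 hfin)) ?_ ?_).symm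
  · rintro _ ⟨y, hy, rfl⟩
    have := (h.sameType (Sum.elim a fun _ : Fin 1 => y) φ).1 hy
    rwa [Sum.comp_elim] at this
  · rw [h.incl_injective.encard_image, hst.encard_solutions_eq]

theorem finite_or_cofinite_solutions [Nonempty α] (hsm : StronglyMinimalTheory L T)
    (hM : M.Models T) (φ : L.Formula (α ⊕ Fin 1)) (a : α → M.carrier) :
    (solutions φ a).Finite ∨ (solutions φ a)ᶜ.Finite := by
  obtain ⟨m, c, ψ, hψ⟩ := exists_fin_restrict_cons φ
  refine hsm.2 _ M.struc hM _ ⟨m, ψ.relabel (Fin.cases (Sum.inl 0) Sum.inr), a ∘ c, ?_⟩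
  ext x
  refine (hψ _ a x).trans (Iff.trans ?_ Formula.realize_relabel.symm)
  refine iff_of_eq (congrArg _ (funext fun i => ?_))
  cases i using Fin.cases <;> rfl

theorem exists_nonalgebraic [Nonempty α] (h : ElemSub M N) (hN : ArithDecidable g N)
    (hM : ¬ IsArithmetical M.carrier) {b : α → M.carrier}
    (hb : IsArithmetical (Set.range fun i => (b i : ℕ))) : ∃ y, Nonalgebraic L b y := by
  by_contra! hcon
  refine hM (arReducible_iff_arPred.2 (ArPred.of_iff
    (P := fun y => ∃ c : ℕ, ∃ q : List ℕ, (∀ z ∈ q, z ∈ Set.range fun i => (b i : ℕ)) ∧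
      Nat.pair c (Encodable.encode (y :: q)) ∈ elemDiagram g N ∧
      ∃ B : ℕ, ∀ z : ℕ, Nat.pair c (Encodable.encode (z :: q)) ∈ elemDiagram g N → z < B)
    ?_ fun y => ?_))
  · refine ArPred.ex (.ex (.and (.forall_mem (.mem_set hb .snd) .snd) (.and (.mem_set hN ?_)
      (.ex (.all (.imp (.mem_set hN ?_) (.lt .snd (Primrec.snd.comp .fst))))))))
    · exact Primrec₂.natPair.comp (Primrec.snd.comp .fst)
        (Primrec.encode.comp (Primrec.list_cons.comp (Primrec.fst.comp .fst) .snd))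
    · exact Primrec₂.natPair.comp (Primrec.snd.comp (Primrec.fst.comp (Primrec.fst.comp .fst)))
        (Primrec.encode.comp (Primrec.list_cons.comp .snd
          (Primrec.snd.comp (Primrec.fst.comp .fst))))
  · constructor
    · intro hy
      obtain ⟨φ, hφ, hfin⟩ : ∃ φ : L.Formula (α ⊕ Fin 1),
          ⟨y, hy⟩ ∈ solutions φ b ∧ (solutions φ b).Finite := by
        simpa [Nonalgebraic] using hcon ⟨y, hy⟩
      have hst := h.sameType b
      rw [hst.finite_solutions_iff] at hfin
      obtain ⟨m, c, ψ, hψ⟩ := exists_fin_restrict_cons φ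
      have hmem : ∀ z, Nat.pair (sizedCode g ψ)
          (Encodable.encode (z :: List.ofFn ((fun i => (b i : ℕ)) ∘ c))) ∈ elemDiagram g N ↔
          z ∈ Subtype.val '' solutions φ (h.incl ∘ b) := fun z => by
        refine (cons_mem_elemDiagram (a := h.incl ∘ b ∘ c)).trans ?_
        constructor
        · rintro ⟨ψ', e, y, rfl, hy⟩
          obtain rfl := formulaCode_injective g Fin.val_injective (Nat.pair_eq_pair.1 e).2
          exact ⟨y, (hψ _ _ _).2 hy, rfl⟩
        · rintro ⟨y, hy, rfl⟩
          exact ⟨ψ, rfl, y, rfl, (hψ _ _ _).1 hy⟩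
      refine ⟨sizedCode g ψ, List.ofFn ((fun i => (b i : ℕ)) ∘ c),
        fun z hz => forall_mem_ofFn_comp hz, (hmem y).2 ⟨h.incl ⟨y, hy⟩, ?_, rfl⟩, ?_⟩
      · have := (h.sameType (Sum.elim b fun _ : Fin 1 => ⟨y, hy⟩) φ).1 hφ
        rwa [Sum.comp_elim] at this
      · obtain ⟨B, hB⟩ := (hfin.image Subtype.val).bddAbove
        exact ⟨B + 1, fun z hz => Nat.lt_succ_of_le (hB ((hmem z).1 hz))⟩
    · rintro ⟨c, q, hq, hy, B, hB⟩
      obtain ⟨k, e, rfl⟩ := exists_eq_ofFn_comp hq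
      obtain ⟨φ, rfl, y, rfl, hsol⟩ := (cons_mem_elemDiagram (a := h.incl ∘ b ∘ e)).1 hy
      rw [← mem_solutions_relabel, h.solutions_eq_image] at hsol
      · obtain ⟨x, -, rfl⟩ := hsol
        exact x.2
      · refine Set.Finite.of_finite_image ((Set.finite_lt_nat B).subset ?_)
          Subtype.val_injective.injOn
        rintro _ ⟨z, hz, rfl⟩
        rw [mem_solutions_relabel] at hz
        exact hB z ((cons_mem_elemDiagram (a := h.incl ∘ b ∘ e)).2 ⟨φ, rfl, z, rfl, hz⟩)

end Algebraic

section BackAndForth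

/-- The relation given by a finite list of pairs together with the identity on `A`. -/
def augment (A : Set ℕ) (s : List (ℕ × ℕ)) : Set (ℕ × ℕ) :=
  { p | p ∈ s ∨ (p.1 = p.2 ∧ p.1 ∈ A) }

/-- The relation `S` preserves membership in the diagrams `E₁` and `E₂`. -/
def CodedElem (E₁ E₂ : Set ℕ) (S : Set (ℕ × ℕ)) : Prop :=
  ∀ (c : ℕ) (q : List (ℕ × ℕ)), (∀ p ∈ q, p ∈ S) →
    (Nat.pair c (Encodable.encode (q.map Prod.fst)) ∈ E₁ ↔
      Nat.pair c (Encodable.encode (q.map Prod.snd)) ∈ E₂)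

/-- A finite list of pairs in `B₁ × B₂` that, together with the identity on `A`, preserves
membership in the diagrams `E₁` and `E₂`. -/
def Good (E₁ E₂ A B₁ B₂ : Set ℕ) (s : List (ℕ × ℕ)) : Prop :=
  (∀ p ∈ s, p.1 ∈ B₁ ∧ p.2 ∈ B₂) ∧ CodedElem E₁ E₂ (augment A s)

theorem Good.swap {E₁ E₂ A B₁ B₂ : Set ℕ} {s : List (ℕ × ℕ)} (h : Good E₁ E₂ A B₁ B₂ s) :
    Good E₂ E₁ A B₂ B₁ (s.map Prod.swap) := by
  constructor
  · simp only [List.mem_map, forall_exists_index, and_imp]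
    rintro _ p hp rfl
    exact (h.1 p hp).symm
  · intro c q hq
    have := h.2 c (q.map Prod.swap) ?_
    · simpa [Function.comp_def] using this.symm
    · simp only [List.mem_map, forall_exists_index, and_imp]
      rintro _ p hp rfl
      rcases hq p hp with k | ⟨k, k'⟩
      · obtain ⟨p', hp', rfl⟩ := List.mem_map.1 k
        exact Or.inl (by simpa using hp')
      · exact Or.inr ⟨k.symm, (k ▸ k' : p.2 ∈ A)⟩

theorem ArPred.good {E₁ E₂ A B₁ B₂ d : Set ℕ} (hE₁ : ArReducible E₁ d) (hE₂ : ArReducible E₂ d)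
    (hA : ArReducible A d) (hB₁ : ArReducible B₁ d) (hB₂ : ArReducible B₂ d) :
    ArPred d (Good E₁ E₂ A B₁ B₂) := by
  refine .and (.forall_mem (.and (.mem_set hB₁ (Primrec.fst.comp .snd))
    (.mem_set hB₂ (Primrec.snd.comp .snd))) .id) (.all (.all (.imp (.forall_mem (.or
      (.mem_list .snd (Primrec.fst.comp (Primrec.fst.comp .fst))) (.and
        (.eq (Primrec.fst.comp .snd) (Primrec.snd.comp .snd))
        (.mem_set hA (Primrec.fst.comp .snd)))) .snd) (.iff (.mem_set hE₁ ?_) (.mem_set hE₂ ?_)))))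
  · exact Primrec₂.natPair.comp (Primrec.snd.comp .fst)
      (Primrec.encode.comp (Primrec.list_map .snd (Primrec.fst.comp .snd)))
  · exact Primrec₂.natPair.comp (Primrec.snd.comp .fst)
      (Primrec.encode.comp (Primrec.list_map .snd (Primrec.snd.comp .snd)))

variable {g : GoedelCoding L} {T : L.Theory} {M₀ M₁ M₂ N₁ N₂ : CodedStructure L} {α : Type}

theorem codedElem_range_iff {a : α → N₁.carrier} {b : α → N₂.carrier} :
    CodedElem (elemDiagram g N₁) (elemDiagram g N₂)
      (Set.range fun i => ((a i : ℕ), (b i : ℕ))) ↔ SameType L a b := by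
  constructor
  · intro h φ
    obtain ⟨m, c, ψ, hψ⟩ := exists_fin_restrict φ
    have := h (sizedCode g ψ) (List.ofFn ((fun i => ((a i : ℕ), (b i : ℕ))) ∘ c))
      fun p hp => forall_mem_ofFn_comp hp
    rw [List.map_ofFn, List.map_ofFn] at this
    rw [hψ, hψ]
    exact mem_elemDiagram.symm.trans (this.trans mem_elemDiagram)
  · intro h c q hq
    obtain ⟨k, e, rfl⟩ := exists_eq_ofFn_comp hq
    rw [List.map_ofFn, List.map_ofFn]
    refine (mem_elemDiagram_ofFn (a := a ∘ e)).trans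
      (Iff.trans ?_ (mem_elemDiagram_ofFn (a := b ∘ e)).symm)
    exact exists_congr fun φ => and_congr_right fun _ => h.comp e φ

theorem codedElem_iff_sameType (h₁ : ElemSub M₁ N₁) (h₂ : ElemSub M₂ N₂) {S : Set (ℕ × ℕ)}
    {a : α → M₁.carrier} {b : α → M₂.carrier} (hS : S = Set.range fun i => ((a i : ℕ), (b i : ℕ))) :
    CodedElem (elemDiagram g N₁) (elemDiagram g N₂) S ↔ SameType L a b := by
  subst hS
  refine (codedElem_range_iff (a := h₁.incl ∘ a) (b := h₂.incl ∘ b)).trans ⟨fun h => ?_, fun h => ?_⟩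
  · exact (h₁.sameType a).trans (h.trans (h₂.sameType b).symm)
  · exact (h₁.sameType a).symm.trans (h.trans (h₂.sameType b))

theorem Good.exists_family (h01 : M₀.carrier ⊆ M₁.carrier) (h02 : M₀.carrier ⊆ M₂.carrier)
    {E₁ E₂ : Set ℕ} {s : List (ℕ × ℕ)}
    (h : Good E₁ E₂ M₀.carrier M₁.carrier M₂.carrier s) :
    ∃ (a : augment M₀.carrier s → M₁.carrier) (b : augment M₀.carrier s → M₂.carrier),
      ∀ p, p.1 = ((a p : ℕ), (b p : ℕ)) := by
  have hmem : ∀ p ∈ augment M₀.carrier s, p.1 ∈ M₁.carrier ∧ p.2 ∈ M₂.carrier := by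
    rintro p (hp | ⟨hp, hA⟩)
    · exact h.1 p hp
    · exact ⟨h01 hA, h02 (hp ▸ hA)⟩
  exact ⟨fun p => ⟨p.1.1, (hmem _ p.2).1⟩, fun p => ⟨p.1.2, (hmem _ p.2).2⟩, fun p => rfl⟩

theorem good_nil (h₁ : ElemSub M₁ N₁) (h₂ : ElemSub M₂ N₂) (h01 : ElemSub M₀ M₁)
    (h02 : ElemSub M₀ M₂) : Good (elemDiagram g N₁) (elemDiagram g N₂) M₀.carrier M₁.carrier
      M₂.carrier [] := by
  refine ⟨by simp, (codedElem_iff_sameType h₁ h₂ (a := h01.incl) (b := h02.incl) ?_).2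
    ((h01.sameType id).symm.trans (h02.sameType id))⟩
  ext ⟨x, y⟩
  constructor
  · rintro (h | ⟨e, h⟩)
    · simp at h
    · obtain rfl : x = y := e
      exact ⟨⟨x, h⟩, rfl⟩
  · rintro ⟨⟨z, hz⟩, h⟩
    obtain ⟨rfl, rfl⟩ := Prod.mk.inj h
    exact Or.inr ⟨rfl, hz⟩

theorem Good.forth (hsm : StronglyMinimalTheory L T) (hM₁ : M₁.Models T)
    (hN₂ : ArithDecidable g N₂) (h₁ : ElemSub M₁ N₁) (h₂ : ElemSub M₂ N₂)
    (h01 : M₀.carrier ⊆ M₁.carrier) (h02 : M₀.carrier ⊆ M₂.carrier)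
    (hne : M₀.carrier.Nonempty) (h0 : IsArithmetical M₀.carrier) (h2 : ¬ IsArithmetical M₂.carrier)
    {s : List (ℕ × ℕ)}
    (h : Good (elemDiagram g N₁) (elemDiagram g N₂) M₀.carrier M₁.carrier M₂.carrier s)
    {x : ℕ} (hx : x ∈ M₁.carrier) :
    ∃ y, Good (elemDiagram g N₁) (elemDiagram g N₂) M₀.carrier M₁.carrier M₂.carrier
      ((x, y) :: s) := by
  obtain ⟨z, hz⟩ := hne
  have : Nonempty (augment M₀.carrier s) := ⟨⟨(z, z), Or.inr ⟨rfl, hz⟩⟩⟩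
  obtain ⟨a, b, hab⟩ := h.exists_family h01 h02
  have hS : augment M₀.carrier s = Set.range fun p => ((a p : ℕ), (b p : ℕ)) := by
    rw [← funext hab]
    exact Subtype.range_coe.symm
  have hst := (codedElem_iff_sameType h₁ h₂ hS).1 h.2
  have hb : IsArithmetical (Set.range fun p => (b p : ℕ)) := by
    refine arReducible_iff_arPred.2 (ArPred.of_iff
      (P := fun y => ∃ x : ℕ, (x, y) ∈ s ∨ (x = y ∧ x ∈ M₀.carrier)) ?_ fun y => ?_)
    · exact .ex (.or (.mem_list (.pair .snd .fst) (.const s))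
        (.and (.eq .snd .fst) (.mem_set h0 .snd)))
    · constructor
      · rintro ⟨p, rfl⟩
        exact ⟨a p, show ((a p : ℕ), (b p : ℕ)) ∈ augment M₀.carrier s from hab p ▸ p.2⟩
      · rintro ⟨x, hx⟩
        obtain ⟨p, hp⟩ := hS.subset (show (x, y) ∈ augment M₀.carrier s from hx)
        exact ⟨p, (Prod.mk.inj hp).2⟩
  obtain ⟨y, hy⟩ := hst.exists_extend (fun φ => finite_or_cofinite_solutions hsm hM₁ φ a)
    (exists_nonalgebraic h₂ hN₂ h2 hb) ⟨x, hx⟩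
  refine ⟨y, ?_, (codedElem_iff_sameType h₁ h₂ ?_).2 hy⟩
  · simp only [List.mem_cons, forall_eq_or_imp]
    exact ⟨⟨hx, y.2⟩, h.1⟩
  · ext p
    have hp := Set.ext_iff.1 hS p
    simp only [augment, Set.mem_ofPred_eq, Set.mem_range, List.mem_cons, Sum.exists]
      at hp ⊢
    rw [or_assoc, hp, or_comm, eq_comm (a := p)]
    exact or_congr Iff.rfl ⟨fun e => ⟨0, e⟩, fun ⟨_, e⟩ => e⟩

theorem Good.back (hsm : StronglyMinimalTheory L T) (hM₂ : M₂.Models T)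
    (hN₁ : ArithDecidable g N₁) (h₁ : ElemSub M₁ N₁) (h₂ : ElemSub M₂ N₂)
    (h01 : M₀.carrier ⊆ M₁.carrier) (h02 : M₀.carrier ⊆ M₂.carrier)
    (hne : M₀.carrier.Nonempty) (h0 : IsArithmetical M₀.carrier) (h1 : ¬ IsArithmetical M₁.carrier)
    {s : List (ℕ × ℕ)}
    (h : Good (elemDiagram g N₁) (elemDiagram g N₂) M₀.carrier M₁.carrier M₂.carrier s)
    {y : ℕ} (hy : y ∈ M₂.carrier) :
    ∃ x, Good (elemDiagram g N₁) (elemDiagram g N₂) M₀.carrier M₁.carrier M₂.carrier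
      ((x, y) :: s) := by
  obtain ⟨x, hx⟩ := h.swap.forth hsm hM₂ hN₁ h₂ h₁ h02 h01 hne h0 h1 hy
  exact ⟨x, by simpa using hx.swap⟩

theorem Good.eq_iff_eq (h₁ : ElemSub M₁ N₁) (h₂ : ElemSub M₂ N₂) (h01 : M₀.carrier ⊆ M₁.carrier)
    (h02 : M₀.carrier ⊆ M₂.carrier) {s : List (ℕ × ℕ)}
    (h : Good (elemDiagram g N₁) (elemDiagram g N₂) M₀.carrier M₁.carrier M₂.carrier s)
    {x x' y y' : ℕ} (k : (x, y) ∈ augment M₀.carrier s) (k' : (x', y') ∈ augment M₀.carrier s) :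
    x = x' ↔ y = y' := by
  obtain ⟨a, b, hab⟩ := h.exists_family h01 h02
  have hS : augment M₀.carrier s = Set.range fun p => ((a p : ℕ), (b p : ℕ)) := by
    rw [← funext hab]
    exact Subtype.range_coe.symm
  have hst := (codedElem_iff_sameType h₁ h₂ hS).1 h.2
  obtain ⟨p, hp⟩ := hS.subset k
  obtain ⟨p', hp'⟩ := hS.subset k'
  obtain ⟨rfl, rfl⟩ := Prod.mk.inj hp
  obtain ⟨rfl, rfl⟩ := Prod.mk.inj hp'
  have := hst (Term.equal (Term.var p) (Term.var p'))
  rw [Formula.realize_equal, Formula.realize_equal] at this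
  rw [Subtype.coe_inj, Subtype.coe_inj]
  exact this

end BackAndForth

section Construction

variable {d B₁ B₂ : Set ℕ} {G : List (ℕ × ℕ) → Prop}

theorem exists_arPred_backAndForth (hG : ArPred d G) (hB₁ : ArReducible B₁ d)
    (hB₂ : ArReducible B₂ d) (h0 : G []) (forth : ∀ s, G s → ∀ x ∈ B₁, ∃ y, G ((x, y) :: s))
    (back : ∀ s, G s → ∀ y ∈ B₂, ∃ x, G ((x, y) :: s)) :
    ∃ R : ℕ → ℕ → Prop, (ArPred d fun p : ℕ × ℕ => R p.1 p.2) ∧ (∀ x ∈ B₁, ∃ y, R x y) ∧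
      (∀ y ∈ B₂, ∃ x, R x y) ∧
      ∀ q : List (ℕ × ℕ), (∀ p ∈ q, R p.1 p.2) → ∃ s, G s ∧ ∀ p ∈ q, p ∈ s := by
  let Next : ℕ → List (ℕ × ℕ) → List (ℕ × ℕ) → Prop := fun n s t =>
    G t ∧ (∀ p ∈ s, p ∈ t) ∧ (n ∈ B₁ → ∃ y, (n, y) ∈ t) ∧ (n ∈ B₂ → ∃ x, (x, n) ∈ t)
  let Step : ℕ → List (ℕ × ℕ) → List (ℕ × ℕ) → Prop := fun n s t =>
    Next n s t ∧ ∀ t', Next n s t' → ¬ Encodable.encode t' < Encodable.encode t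
  have hNext : ∀ n s, G s → ∃ t, Next n s t := by
    intro n s hs
    obtain ⟨t, ht, hst, hn⟩ : ∃ t, G t ∧ (∀ p ∈ s, p ∈ t) ∧ (n ∈ B₁ → ∃ y, (n, y) ∈ t) := by
      by_cases hn : n ∈ B₁
      · obtain ⟨y, hy⟩ := forth s hs n hn
        exact ⟨_, hy, fun p => List.mem_cons_of_mem _, fun _ => ⟨y, List.mem_cons_self⟩⟩
      · exact ⟨s, hs, fun p => id, fun k => absurd k hn⟩
    by_cases hn' : n ∈ B₂
    · obtain ⟨x, hx⟩ := back t ht n hn'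
      exact ⟨_, hx, fun p hp => List.mem_cons_of_mem _ (hst p hp), fun k =>
        (hn k).imp fun _ => List.mem_cons_of_mem _, fun _ => ⟨x, List.mem_cons_self⟩⟩
    · exact ⟨t, ht, hst, hn, fun k => absurd k hn'⟩
  have hStep : ∀ n s, G s → ∃ t, Step n s t := fun n s hs =>
    (InvImage.wf (fun t : List (ℕ × ℕ) => Encodable.encode t) wellFounded_lt).has_min
      { t | Next n s t } (hNext n s hs)
  have hunique : ∀ n s t t', Step n s t → Step n s t' → t = t' := fun n s t t' h h' =>
    Encodable.encode_injective
      (le_antisymm (not_lt.1 (h.2 t' h'.1)) (not_lt.1 (h'.2 t h.1)))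
  choose! next hnext using hStep
  let F : ℕ → List (ℕ × ℕ) := fun n => Nat.rec [] next n
  have hGF : ∀ n, G (F n) := fun n => by
    induction n with
    | zero => exact h0
    | succ n ih => exact (hnext n _ ih).1.1
  have hF : ∀ n, Step n (F n) (F (n + 1)) := fun n => hnext n _ (hGF n)
  have hmono : ∀ m n, m ≤ n → ∀ p ∈ F m, p ∈ F n := by
    intro m n hmn p hp
    induction hmn with
    | refl => exact hp
    | step _ ih => exact (hF _).1.2.1 p ih
  let Chain : List (List (ℕ × ℕ)) → Prop := fun l => l[0]? = some [] ∧
    ∀ i s t, l[i]? = some s → l[i + 1]? = some t → Step i s t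
  have hchain : ∀ l, Chain l → ∀ i s, l[i]? = some s → s = F i := by
    intro l hl i
    induction i with
    | zero =>
      intro s hs
      exact Option.some_injective _ (hs.symm.trans hl.1)
    | succ i ih =>
      intro t ht
      have hlt : i < l.length := (Nat.lt_succ_self i).trans (List.getElem?_eq_some_iff.1 ht).1
      have hi := List.getElem?_eq_getElem hlt
      have := hl.2 i _ t hi ht
      rw [ih _ hi] at this
      exact hunique _ _ _ _ this (hF i)
  have hArNext : ArPred d fun p : (ℕ × List (ℕ × ℕ)) × List (ℕ × ℕ) => Next p.1.1 p.1.2 p.2 := by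
    refine .and (hG.comp .snd) (.and (.forall_mem
      (.mem_list .snd (Primrec.snd.comp .fst)) (Primrec.snd.comp .fst)) (.and
        (.imp (.mem_set hB₁ (Primrec.fst.comp .fst)) (.ex (.mem_list ?_ ?_)))
        (.imp (.mem_set hB₂ (Primrec.fst.comp .fst)) (.ex (.mem_list ?_ ?_)))))
    · exact .pair (Primrec.fst.comp (Primrec.fst.comp .fst)) .snd
    · exact Primrec.snd.comp .fst
    · exact .pair .snd (Primrec.fst.comp (Primrec.fst.comp .fst))
    · exact Primrec.snd.comp .fst
  have hArStep : ArPred d fun p : (ℕ × List (ℕ × ℕ)) × List (ℕ × ℕ) => Step p.1.1 p.1.2 p.2 :=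
    .and hArNext (.all (.imp (hArNext.comp (.pair (Primrec.fst.comp .fst) .snd))
      (.not (.lt (Primrec.encode.comp .snd) (Primrec.encode.comp (Primrec.snd.comp .fst))))))
  have hArChain : ArPred d Chain := by
    refine .and (.eq (Primrec.list_getElem?.comp .id (.const 0)) (.const _))
      (.all (.all (.all (.imp (.eq ?_ ?_) (.imp (.eq ?_ ?_) (hArStep.comp
        (f := fun p : ((List (List (ℕ × ℕ)) × ℕ) × List (ℕ × ℕ)) × List (ℕ × ℕ) =>
          ((p.1.1.2, p.1.2), p.2)) ?_))))))
    · exact Primrec.list_getElem?.comp (Primrec.fst.comp (Primrec.fst.comp .fst))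
        (Primrec.snd.comp (Primrec.fst.comp .fst))
    · exact Primrec.option_some.comp (Primrec.snd.comp .fst)
    · exact Primrec.list_getElem?.comp (Primrec.fst.comp (Primrec.fst.comp .fst))
        (Primrec.succ.comp (Primrec.snd.comp (Primrec.fst.comp .fst)))
    · exact Primrec.option_some.comp .snd
    · exact .pair (.pair (Primrec.snd.comp (Primrec.fst.comp .fst)) (Primrec.snd.comp .fst)) .snd
  refine ⟨fun x y => ∃ n, (x, y) ∈ F n, ?_, fun x hx => ?_, fun y hy => ?_, fun q hq => ?_⟩
  · refine ArPred.of_iff (P := fun p : ℕ × ℕ => ∃ l, Chain l ∧ ∃ s ∈ l, p ∈ s)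
      (.ex (.and (hArChain.comp .snd) (.exists_mem (.mem_list (Primrec.fst.comp .fst) .snd) .snd)))
      fun p => ?_
    constructor
    · rintro ⟨n, hn⟩
      refine ⟨(List.range (n + 1)).map F, ⟨by simp [F], fun i s t hs ht => ?_⟩, F n, ?_, hn⟩
      · rw [List.getElem?_map, Option.map_eq_some_iff] at hs ht
        obtain ⟨j, hj, rfl⟩ := hs
        obtain ⟨k, hk, rfl⟩ := ht
        rw [List.getElem?_eq_some_iff] at hj hk
        simp only [List.getElem_range] at hj hk
        obtain ⟨-, rfl⟩ := hj
        obtain ⟨-, rfl⟩ := hk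
        exact hF i
      · exact List.mem_map_of_mem (List.mem_range.2 (Nat.lt_succ_self n))
    · rintro ⟨l, hl, s, hs, hp⟩
      obtain ⟨i, hi⟩ := List.mem_iff_getElem?.1 hs
      exact ⟨i, hchain l hl i s hi ▸ hp⟩
  · exact ((hF x).1.2.2.1 hx).imp fun y hy => ⟨x + 1, hy⟩
  · exact ((hF y).1.2.2.2 hy).imp fun x hx => ⟨y + 1, hx⟩
  · suffices ∃ n, ∀ p ∈ q, p ∈ F n from this.elim fun n hn => ⟨F n, hGF n, hn⟩
    induction q with
    | nil => exact ⟨0, by simp⟩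
    | cons p q ih =>
      obtain ⟨n, hn⟩ := ih fun p' hp' => hq p' (List.mem_cons_of_mem _ hp')
      obtain ⟨m, hm⟩ := hq p List.mem_cons_self
      refine ⟨max m n, fun p' hp' => ?_⟩
      rcases List.mem_cons.1 hp' with rfl | hp'
      · exact hmono m _ (le_max_left _ _) _ hm
      · exact hmono n _ (le_max_right _ _) _ (hn p' hp')

end Construction

section Definable

variable {g : GoedelCoding L} {T : L.Theory} {M N : CodedStructure L} {d : Set ℕ} {n : ℕ}

theorem DefinableIn.arReducible {X : Set (Fin n → M.carrier)} (hX : DefinableIn M X)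
    (h : ElemSub M N) (hN : ArithDecidable g N) (hM : ArReducible M.carrier d) :
    ArReducible (tupleSetCode X) d := by
  obtain ⟨m, ψ, b, -, rfl⟩ := hX
  let χ : L.Formula (Fin (n + m)) := ψ.relabel finSumFinEquiv
  have key : ∀ v : Fin n → M.carrier, Nat.pair (sizedCode g χ) (Encodable.encode
      ((List.ofFn fun i => (v i : ℕ)) ++ List.ofFn fun i => (b i : ℕ))) ∈ elemDiagram g N ↔
      ψ.Realize (Sum.elim v b) := fun v => by
    have e : ((List.ofFn fun i => (v i : ℕ)) ++ List.ofFn fun i => (b i : ℕ)) =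
        List.ofFn fun i => (h.incl (Fin.append v b i) : ℕ) := by
      rw [← List.ofFn_fin_append]
      congr 1
      funext i
      cases i using Fin.addCases with
      | left i =>
        rw [Fin.append_left, Fin.append_left]
        rfl
      | right i =>
        rw [Fin.append_right, Fin.append_right]
        rfl
    rw [e, mem_elemDiagram, Formula.realize_relabel]
    refine ((h.sameType _ ψ).trans (iff_of_eq (congrArg _ (funext fun i => ?_)))).symm
    rcases i with i | i
    · simp
    · simp
  refine arReducible_iff_arPred.2 (ArPred.of_iff (P := fun c => ∃ l : List ℕ,
    c = Encodable.encode l ∧ l.length = n ∧ (∀ z ∈ l, z ∈ M.carrier) ∧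
      Nat.pair (sizedCode g χ) (Encodable.encode (l ++ List.ofFn fun i => (b i : ℕ))) ∈
        elemDiagram g N) ?_ fun c => ?_)
  · exact .ex (.and (.eq .fst (Primrec.encode.comp .snd))
      (.and (.eq (Primrec.list_length.comp .snd) (.const n))
        (.and (.forall_mem (.mem_set hM .snd) .snd) (.mem_set (.of_isArithmetical hN d)
          (Primrec₂.natPair.comp (.const _)
            (Primrec.encode.comp (Primrec.list_append.comp .snd (.const _))))))))
  · constructor
    · rintro ⟨v, hv, rfl⟩
      refine ⟨_, rfl, List.length_ofFn, fun z hz => ?_, (key v).2 hv⟩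
      obtain ⟨i, rfl⟩ := (List.mem_ofFn' _ _).1 hz
      exact (v i).2
    · rintro ⟨l, rfl, hl, hmem, hE⟩
      obtain ⟨k, v, rfl⟩ := exists_eq_ofFn_comp (f := (Subtype.val : M.carrier → ℕ))
        fun z hz => ⟨⟨z, hmem z hz⟩, rfl⟩
      obtain rfl : k = n := by simpa using hl
      exact ⟨v, (key v).1 hE, rfl⟩

theorem DefinableIn.carrier_arReducible (hsm : StronglyMinimalTheory L T) (hM : M.Models T)
    {X : Set (Fin n → M.carrier)} (hX : DefinableIn M X) (hinf : X.Infinite) :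
    ArReducible M.carrier (tupleSetCode X) := by
  obtain ⟨i, hi⟩ : ∃ i, ((fun v : Fin n → M.carrier => v i) '' X).Infinite := by
    by_contra! hcon
    exact hinf ((Set.Finite.pi' hcon).subset fun v hv i => ⟨v, hv, rfl⟩)
  have hcof : ((fun v : Fin n → M.carrier => v i) '' X)ᶜ.Finite := by
    refine (hsm.2 _ M.struc hM _ ?_).resolve_left hi
    obtain ⟨m, ψ, b, -, rfl⟩ := hX
    let χ : L.Formula ((Fin 1 ⊕ Fin m) ⊕ Fin n) :=
      ψ.relabel (Sum.elim Sum.inr (Sum.inl ∘ Sum.inr)) ⊓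
        Term.equal (Term.var (Sum.inr i)) (Term.var (Sum.inl (Sum.inl 0)))
    refine ⟨m, χ.iExs (Fin n), b, ?_⟩
    ext x
    refine Iff.trans (exists_congr fun v => ?_) Formula.realize_iExs.symm
    rw [Formula.realize_inf, Formula.realize_relabel, Formula.realize_equal]
    refine and_congr (iff_of_eq (congrArg ψ.Realize (funext fun j => ?_) :
      ψ.Realize (Sum.elim v b) = _)) Iff.rfl
    rcases j with j | j <;> rfl
  refine arReducible_iff_arPred.2 (ArPred.of_iff (P := fun x => (∃ l : List ℕ,
    Encodable.encode l ∈ tupleSetCode X ∧ l[(i : ℕ)]? = some x) ∨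
      x ∈ Subtype.val '' ((fun v : Fin n → M.carrier => v i) '' X)ᶜ) ?_ fun x => ?_)
  · exact .or (.ex (.and (.mem_set (.refl _) (Primrec.encode.comp .snd))
      (.eq (Primrec.list_getElem?.comp .snd (.const _)) (Primrec.option_some.comp .fst))))
      (.mem_set (.of_isArithmetical (isArithmetical_of_finite (hcof.image _)) _) .id)
  · have hget : ∀ v : Fin n → M.carrier, (List.ofFn fun j => (v j : ℕ))[(i : ℕ)]? =
        some (v i : ℕ) := fun v => by simp
    constructor
    · intro hx
      by_cases hX : (⟨x, hx⟩ : M.carrier) ∈ (fun v : Fin n → M.carrier => v i) '' X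
      · obtain ⟨v, hv, e⟩ := hX
        refine Or.inl ⟨_, ⟨v, hv, rfl⟩, (hget v).trans ?_⟩
        rw [show v i = ⟨x, hx⟩ from e]
      · exact Or.inr ⟨_, hX, rfl⟩
    · rintro (⟨l, ⟨v, hv, e⟩, hx⟩ | ⟨y, -, rfl⟩)
      · obtain rfl := Encodable.encode_injective e
        rw [hget] at hx
        exact Option.some_injective _ hx ▸ (v i).2
      · exact y.2

theorem isArithmetical_tupleSetCode_of_finite {X : Set (Fin n → M.carrier)} (h : X.Finite) :
    IsArithmetical (tupleSetCode X) := by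
  refine isArithmetical_of_finite ((h.image fun v => tupleCode fun i => (v i : ℕ)).subset ?_)
  rintro _ ⟨v, hv, rfl⟩
  exact ⟨v, hv, rfl⟩

/-- The inverse of an isomorphism of coded structures. -/
def CodedIso.symm (f : CodedIso M N) : CodedIso N M where
  toFun := f.invFun
  invFun := f.toFun
  left_inv := f.right_inv
  right_inv := f.left_inv
  map_fun F v := f.left_inv.injective <| by
    rw [f.map_fun, f.right_inv, ← Function.comp_assoc, f.right_inv.comp_eq_id, Function.id_comp]
  map_rel r v := by
    rw [f.map_rel, ← Function.comp_assoc, f.right_inv.comp_eq_id, Function.id_comp]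

/-- An isomorphism of coded structures as a first-order isomorphism. -/
def CodedIso.toEquiv (f : CodedIso M N) : M.carrier ≃[L] N.carrier where
  toFun := f.toFun
  invFun := f.invFun
  left_inv := f.left_inv
  right_inv := f.right_inv
  map_fun' F v := f.map_fun F v
  map_rel' r v := (f.map_rel r v).symm

theorem DefinableIn.image {X : Set (Fin n → M.carrier)} (hX : DefinableIn M X)
    (f : CodedIso M N) : DefinableIn N ((fun v => f.toFun ∘ v) '' X) := by
  obtain ⟨m, ψ, b, -, rfl⟩ := hX
  have key : ∀ v, ψ.Realize (Sum.elim (f.toFun ∘ v) (f.toFun ∘ b)) ↔ ψ.Realize (Sum.elim v b) :=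
    fun v => by
      rw [← Sum.comp_elim]
      exact StrongHomClass.realize_formula f.toEquiv ψ
  refine ⟨m, ψ, f.toFun ∘ b, fun _ => trivial, ?_⟩
  ext v
  constructor
  · rintro ⟨v, hv, rfl⟩
    exact (key v).2 hv
  · intro hv
    have e : f.toFun ∘ f.invFun ∘ v = v := by
      rw [← Function.comp_assoc, f.right_inv.comp_eq_id, Function.id_comp]
    exact ⟨f.invFun ∘ v, (key _).1 (e.symm ▸ hv), e⟩

theorem arEquiv_tupleSetCode_image (hsm : StronglyMinimalTheory L T) (hd : ¬ IsArithmetical d)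
    (f : CodedIso M N) (hN : N.Models T) (hext : ArithExtendible g T N)
    (hNd : ArEquiv N.carrier d) {X : Set (Fin n → M.carrier)} (hX : DefinableIn M X)
    (hXd : ArEquiv (tupleSetCode X) d) :
    ArEquiv (tupleSetCode ((fun v => f.toFun ∘ v) '' X)) d := by
  obtain ⟨K, hK, -, hNK⟩ := hext
  have hinf : X.Infinite := fun h => hd (hXd.2.trans (isArithmetical_tupleSetCode_of_finite h))
  have hinj : Function.Injective fun v : Fin n → M.carrier => f.toFun ∘ v :=
    f.left_inv.injective.comp_left
  exact ⟨(hX.image f).arReducible hNK hK hNd.1,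
    hNd.2.trans ((hX.image f).carrier_arReducible hsm hN (hinf.image hinj.injOn))⟩

end Definable

section Assembly

variable {M N : CodedStructure L}

/-- The isomorphism of coded structures given by a type-preserving bijection. -/
def CodedIso.ofSameType (f : M.carrier → N.carrier) (h : N.carrier → M.carrier)
    (hl : Function.LeftInverse h f) (hr : Function.RightInverse h f) (hf : SameType L id f) :
    CodedIso M N where
  toFun := f
  invFun := h
  left_inv := hl
  right_inv := hr
  map_fun F v := by
    have := (hf (Term.equal (Term.var (M.struc.funMap F v))
      (Term.func F fun i => Term.var (v i)))).1 (Formula.realize_equal.2 rfl)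
    exact Formula.realize_equal.1 this
  map_rel r v := by
    have := hf (r.formula fun i => Term.var (v i))
    rw [Formula.realize_rel, Formula.realize_rel] at this
    exact this

end Assembly

/-- **Strongly minimal theories are `D`-categorical** for every nonzero arithmetic
degree `D`. -/
theorem strongly_minimal_D_categorical
    (L : FirstOrder.Language) (g : GoedelCoding L) (hL : ArithLang g)
    (T : L.Theory) (hT : ArithTheory g T) (hcomp : T.IsComplete)
    (hsm : StronglyMinimalTheory L T)
    (d : Set ℕ) (hd : ¬ IsArithmetical d) :
    DCategorical g T d := by
  intro M₀ M₁ M₂ hM₀ hT₀ hT₁ hext₁ hT₂ hext₂ h01 h02 hd₁ hd₂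
  obtain ⟨N₁, hN₁, -, h₁⟩ := id hext₁
  obtain ⟨N₂, hN₂, -, h₂⟩ := id hext₂
  have hinf : Infinite M₀.carrier := hsm.1 _ M₀.struc hT₀
  have hne : M₀.carrier.Nonempty := Set.nonempty_coe_sort.1 inferInstance
  have h0 := hM₀.isArithmetical_carrier
  have hna₁ : ¬ IsArithmetical M₁.carrier := fun k => hd (hd₁.2.trans k)
  have hna₂ : ¬ IsArithmetical M₂.carrier := fun k => hd (hd₂.2.trans k)
  obtain ⟨R, hR, htot, hsurj, hfin⟩ := exists_arPred_backAndForth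
    (ArPred.good (.of_isArithmetical hN₁ d) (.of_isArithmetical hN₂ d) (.of_isArithmetical h0 d)
      hd₁.1 hd₂.1) hd₁.1 hd₂.1 (good_nil h₁ h₂ h01 h02)
    (fun s hs x hx =>
      hs.forth hsm hT₁ hN₂ h₁ h₂ h01.subset h02.subset hne h0 hna₂ hx)
    (fun s hs y hy =>
      hs.back hsm hT₂ hN₁ h₁ h₂ h01.subset h02.subset hne h0 hna₁ hy)
  have hmem : ∀ x y, R x y → x ∈ M₁.carrier ∧ y ∈ M₂.carrier := fun x y hxy => by
    obtain ⟨s, hs, hq⟩ := hfin [(x, y)] (by simpa using hxy)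
    exact hs.1 _ (hq _ (List.mem_singleton_self _))
  have heq : ∀ x y x' y', R x y → R x' y' → (x = x' ↔ y = y') := fun x y x' y' h h' => by
    obtain ⟨s, hs, hq⟩ := hfin [(x, y), (x', y')] (by simpa using ⟨h, h'⟩)
    exact hs.eq_iff_eq h₁ h₂ h01.subset h02.subset (Or.inl (hq _ (by simp)))
      (Or.inl (hq _ (by simp)))
  have hfix : ∀ x y, x ∈ M₀.carrier → R x y → y = x := fun x y hx h => by
    obtain ⟨s, hs, hq⟩ := hfin [(x, y)] (by simpa using h)
    exact (hs.eq_iff_eq h₁ h₂ h01.subset h02.subset (Or.inl (hq _ (by simp)))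
      (Or.inr ⟨rfl, hx⟩)).1 rfl
  have hf : ∀ x : M₁.carrier, ∃ y : M₂.carrier, R x y := fun x =>
    (htot x x.2).elim fun y hy => ⟨⟨y, (hmem _ _ hy).2⟩, hy⟩
  have hk : ∀ y : M₂.carrier, ∃ x : M₁.carrier, R x y := fun y =>
    (hsurj y y.2).elim fun x hx => ⟨⟨x, (hmem _ _ hx).1⟩, hx⟩
  choose f hf using hf
  choose k hk using hk
  have hst : SameType L id f := by
    refine (codedElem_iff_sameType (g := g) h₁ h₂ rfl).1 fun c q hq => ?_
    obtain ⟨s, hs, hqs⟩ := hfin q fun p hp => by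
      obtain ⟨x, rfl⟩ := hq p hp
      exact hf x
    exact hs.2 c q fun p hp => Or.inl (hqs p hp)
  let F : CodedIso M₁ M₂ := .ofSameType f k
    (fun x => Subtype.ext ((heq _ _ _ _ (hk (f x)) (hf x)).2 rfl))
    (fun y => Subtype.ext ((heq _ _ _ _ (hf (k y)) (hk y)).1 rfl)) hst
  refine ⟨F, ⟨?_, ?_, fun n X hX hXd => ?_, fun n Y hY hYd => ?_⟩, fun x hx hx₁ =>
    hfix x _ hx (hf ⟨x, hx₁⟩)⟩
  · refine arReducible_iff_arPred.2 ((hR.comp Primrec.unpair).of_iff fun c => ⟨?_, fun hc => ?_⟩)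
    · rintro ⟨x, rfl⟩
      rw [Nat.unpair_pair]
      exact hf x
    · refine ⟨⟨_, (hmem _ _ hc).1⟩, ?_⟩
      exact (Nat.pair_unpair c).symm.trans (congrArg (Nat.pair _)
        ((heq _ _ _ _ hc (hf ⟨_, (hmem _ _ hc).1⟩)).1 rfl))
  · refine arReducible_iff_arPred.2 ((hR.comp (Primrec.pair (Primrec.snd.comp Primrec.unpair)
      (Primrec.fst.comp Primrec.unpair))).of_iff fun c => ⟨?_, fun hc => ?_⟩)
    · rintro ⟨y, rfl⟩
      rw [Nat.unpair_pair]
      exact hk y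
    · refine ⟨⟨_, (hmem _ _ hc).2⟩, ?_⟩
      exact (Nat.pair_unpair c).symm.trans (congrArg (Nat.pair _)
        ((heq _ _ _ _ hc (hk ⟨_, (hmem _ _ hc).2⟩)).2 rfl))
  · exact arEquiv_tupleSetCode_image hsm hd F hT₂ hext₂ hd₂ hX hXd
  · exact arEquiv_tupleSetCode_image hsm hd F.symm hT₁ hext₁ hd₁ hY hYd

end ArMorley
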